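/- arXiv:1706.02212 — 4 statements merged into one kernel-verified Lean document; each statement's English description precedes it below -/
import Mathlib

section
/- Let d ≥ 1, let σ be a state on ℂ^d and let ε ∈ (0,1]. Then there exists a unique state ρ ∈ B_ε(σ) such that ρ ≺ ω for every state ω ∈ B_ε(σ). Moreover, this state ρ satisfies: either ρ = (1/d)·I (the completely mixed state) or (1/2)‖ρ − σ‖₁ = ε. -/
open scoped BigOperators ComplexOrder

noncomputable section

/-- A quantum state on `ℂ^d`: a positive semidefinite `d × d` complex matrix of trace 1. -/
def MState (d : ℕ) : Type :=
  {m : Matrix (Fin d) (Fin d) ℂ // m.PosSemidef ∧ m.trace = 1}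

/-- Eigenvalues of a matrix (junk value `0` if the matrix is not Hermitian). -/
noncomputable def eigs {d : ℕ} (A : Matrix (Fin d) (Fin d) ℂ) : Fin d → ℝ :=
  if h : A.IsHermitian then h.eigenvalues else 0

/-- The trace norm of a Hermitian matrix: the sum of the absolute values of its eigenvalues. -/
noncomputable def traceNorm {d : ℕ} (A : Matrix (Fin d) (Fin d) ℂ) : ℝ :=
  ∑ i, |eigs A i|

/-- Membership in the ε-ball (in trace distance) around the state `σ`:
`ω ∈ B_ε(σ) ↔ (1/2)‖ω − σ‖₁ ≤ ε`. -/
def inBall {d : ℕ} (ε : ℝ) (σ ω : MState d) : Prop :=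
  (1 / 2 : ℝ) * traceNorm (ω.1 - σ.1) ≤ ε

/-- Sum of the `k` largest entries of a vector (counted with multiplicity). -/
noncomputable def kMaxSum {d : ℕ} (v : Fin d → ℝ) (k : ℕ) : ℝ :=
  sSup ((fun s : Finset (Fin d) => ∑ i ∈ s, v i) '' {s | s.card = k})

/-- Vector majorization `x ≺ y`: for each `k = 1, …, d` the sum of the `k` largest entries of
`x` is at most that of `y`, with equality at `k = d`. -/
def vMaj {d : ℕ} (x y : Fin d → ℝ) : Prop :=
  (∀ k, 1 ≤ k → k ≤ d → kMaxSum x k ≤ kMaxSum y k) ∧ kMaxSum x d = kMaxSum y d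

/-- State majorization `ρ ≺ σ` (majorization of the eigenvalue vectors). -/
def Maj {d : ℕ} (ρ σ : MState d) : Prop :=
  vMaj (eigs ρ.1) (eigs σ.1)

/-- Two states are unitarily equivalent iff they have the same eigenvalues with the same
multiplicities. -/
def UnitarilyEquiv {d : ℕ} (ρ σ : MState d) : Prop :=
  ∃ π : Equiv.Perm (Fin d), eigs ρ.1 = eigs σ.1 ∘ π

/-- The von Neumann entropy (base 2): the Shannon entropy of the eigenvalues. -/
noncomputable def vnEnt {d : ℕ} (ρ : MState d) : ℝ :=
  -∑ i, eigs ρ.1 i * Real.logb 2 (eigs ρ.1 i)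

/-- The completely mixed state matrix `(1/d)·I`. -/
noncomputable def mixedMat (d : ℕ) : Matrix (Fin d) (Fin d) ℂ :=
  ((d : ℂ)⁻¹) • 1

lemma sum_le_pos {d : ℕ} (x : Fin d → ℝ) (s : Finset (Fin d)) (t : ℝ) :
    ∑ i ∈ s, x i ≤ s.card * t + ∑ i, max (x i - t) 0 := by
  have h1 : ∑ i ∈ s, x i ≤ ∑ i ∈ s, (t + max (x i - t) 0) :=
    Finset.sum_le_sum fun i _ => by linarith [le_max_left (x i - t) 0]
  have h2 : ∑ i ∈ s, max (x i - t) 0 ≤ ∑ i, max (x i - t) 0 :=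
    Finset.sum_le_sum_of_subset_of_nonneg (Finset.subset_univ _) fun i _ _ => le_max_right _ _
  rw [Finset.sum_add_distrib, Finset.sum_const, nsmul_eq_mul] at h1
  linarith

lemma kMaxSum_le {d : ℕ} (x : Fin d → ℝ) {k : ℕ} (hk : k ≤ d) (t : ℝ) :
    kMaxSum x k ≤ k * t + ∑ i, max (x i - t) 0 := by
  apply csSup_le
  · obtain ⟨s, -, hs⟩ := Finset.exists_subset_card_eq (s := (Finset.univ : Finset (Fin d)))
      (n := k) (by simpa using hk)
    exact ⟨_, s, hs, rfl⟩
  · rintro _ ⟨s, hs, rfl⟩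
    have hs' : s.card = k := hs
    have := sum_le_pos x s t
    rwa [hs'] at this

lemma le_kMaxSum {d : ℕ} (x : Fin d → ℝ) {k : ℕ} (s : Finset (Fin d)) (hs : s.card = k) :
    ∑ i ∈ s, x i ≤ kMaxSum x k := by
  apply le_csSup
  · exact (Set.toFinite _).bddAbove
  · exact ⟨s, hs, rfl⟩

/-- For sorted vectors the top-k sum is attained on an initial segment. -/
lemma sorted_sum {d : ℕ} (x : Fin d → ℝ) (e : Equiv.Perm (Fin d)) (hx : Antitone (x ∘ e))
    (k : ℕ) (hk : k < d) :
    kMaxSum x (k + 1) = (k + 1 : ℕ) * x (e ⟨k, hk⟩) + ∑ i, max (x i - x (e ⟨k, hk⟩)) 0 ∧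
    kMaxSum x (k + 1) = ∑ i ∈ Finset.univ.filter (fun i : Fin d => (i : ℕ) < k + 1), x (e i) := by
  set t := x (e ⟨k, hk⟩) with ht
  set S : Finset (Fin d) := Finset.univ.filter (fun i : Fin d => (i : ℕ) < k + 1) with hS
  have hc : S.card = k + 1 := by
    have : S = (Finset.univ : Finset (Fin (k+1))).map (Fin.castLEEmb hk) := by
      ext i
      simp only [hS, Finset.mem_filter, Finset.mem_univ, true_and, Finset.mem_map]
      constructor
      · intro h
        exact ⟨⟨i, h⟩, rfl⟩
      · rintro ⟨j, rfl⟩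
        exact j.2
    rw [this]; simp
  have h1 := kMaxSum_le x (k := k + 1) hk t
  have h2 := le_kMaxSum x (k := k + 1) (S.map e.toEmbedding) (by simpa using hc)
  rw [Finset.sum_map] at h2
  have h3 : ∑ i ∈ S, x (e i) = (k + 1 : ℕ) * t + ∑ i, max (x i - t) 0 := by
    rw [← Equiv.sum_comp e (fun i => max (x i - t) 0), ← hc, ← nsmul_eq_mul, ← Finset.sum_const]
    have : ∑ i, max (x (e i) - t) 0 = ∑ i ∈ S, (x (e i) - t) := by
      rw [hS, Finset.sum_filter]
      refine Finset.sum_congr rfl fun i _ => ?_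
      split_ifs with h
      · apply max_eq_left
        have : x (e ⟨k, hk⟩) ≤ x (e i) := hx (show i ≤ ⟨k, hk⟩ from Nat.lt_succ_iff.mp h)
        linarith
      · apply max_eq_right
        have : x (e i) ≤ x (e ⟨k, hk⟩) := hx (show (⟨k, hk⟩ : Fin d) ≤ i from by
          show k ≤ (i : ℕ)
          omega)
        linarith
    rw [this, ← Finset.sum_add_distrib]
    exact Finset.sum_congr rfl fun i _ => by ring
  have h2' : ∑ i ∈ S, x (e i) ≤ kMaxSum x (k + 1) := h2
  constructor <;> linarith

lemma exists_sort {d : ℕ} (x : Fin d → ℝ) : ∃ e : Equiv.Perm (Fin d), Antitone (x ∘ e) := by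
  refine ⟨Tuple.sort (-x), fun i j h => ?_⟩
  have := Tuple.monotone_sort (-x) h
  simpa using this

lemma kMaxSum_top {d : ℕ} (x : Fin d → ℝ) : kMaxSum x d = ∑ i, x i := by
  have : {s : Finset (Fin d) | s.card = d} = {Finset.univ} := by
    ext s
    simp [← Finset.card_eq_iff_eq_univ]
  unfold kMaxSum
  rw [this]; simp

lemma vMaj_of_pos {d : ℕ} (x y : Fin d → ℝ) (hs : ∑ i, x i = ∑ i, y i)
    (h : ∀ t, ∑ i, max (x i - t) 0 ≤ ∑ i, max (y i - t) 0) : vMaj x y := by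
  refine ⟨fun k hk1 hkd => ?_, by rw [kMaxSum_top, kMaxSum_top, hs]⟩
  obtain ⟨e, he⟩ := exists_sort y
  obtain ⟨k, rfl⟩ : ∃ j, k = j + 1 := ⟨k - 1, by omega⟩
  have h1 := (sorted_sum y e he k hkd).1
  have h2 := kMaxSum_le x hkd (y (e ⟨k, hkd⟩))
  have h3 := h (y (e ⟨k, hkd⟩))
  linarith

lemma sum_sq_eq {d : ℕ} (x y : Fin d → ℝ) (h1 : vMaj x y) (h2 : vMaj y x) :
    ∑ i, x i ^ 2 = ∑ i, y i ^ 2 := by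
  obtain ⟨e, he⟩ := exists_sort x
  obtain ⟨f, hf⟩ := exists_sort y
  have key : ∀ k, k < d → 
      ∑ i ∈ Finset.univ.filter (fun i : Fin d => (i : ℕ) < k + 1), x (e i) =
      ∑ i ∈ Finset.univ.filter (fun i : Fin d => (i : ℕ) < k + 1), y (f i) := fun k hk => by
    rw [← (sorted_sum x e he k hk).2, ← (sorted_sum y f hf k hk).2]
    exact le_antisymm (h1.1 _ (by omega) hk) (h2.1 _ (by omega) hk)
  have split : ∀ (g : Fin d → ℝ) (i : Fin d),
      ∑ j ∈ Finset.univ.filter (fun j : Fin d => (j : ℕ) < i + 1), g j =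
      g i + ∑ j ∈ Finset.univ.filter (fun j : Fin d => (j : ℕ) < i), g j := fun g i => by
    rw [← Finset.sum_insert (by simp)]
    congr 1
    ext j
    simp only [Finset.mem_filter, Finset.mem_univ, true_and, Finset.mem_insert, Fin.ext_iff]
    omega
  have pt : ∀ i, x (e i) = y (f i) := fun i => by
    have a := key i i.2
    rw [split (fun i => x (e i)), split (fun i => y (f i))] at a
    have b : ∑ j ∈ Finset.univ.filter (fun j : Fin d => (j : ℕ) < i), x (e j) =
        ∑ j ∈ Finset.univ.filter (fun j : Fin d => (j : ℕ) < i), y (f j) := by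
      rcases Nat.eq_zero_or_pos (i : ℕ) with h | h
      · simp [h]
      · obtain ⟨k, hk⟩ : ∃ k, (i : ℕ) = k + 1 := ⟨i - 1, by omega⟩
        rw [hk]
        exact key k (by omega)
    linarith
  rw [← Equiv.sum_comp e, ← Equiv.sum_comp f (fun i => y i ^ 2)]
  exact Finset.sum_congr rfl fun i _ => by rw [pt]

open Matrix

/-- `U diag(v) U*`. -/
def fcU {d : ℕ} (U : Matrix (Fin d) (Fin d) ℂ) (v : Fin d → ℝ) : Matrix (Fin d) (Fin d) ℂ :=
  U * diagonal (fun i => (v i : ℂ)) * Uᴴ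

lemma fcU_sub {d : ℕ} (U : Matrix (Fin d) (Fin d) ℂ) (v w : Fin d → ℝ) :
    fcU U v - fcU U w = fcU U (fun i => v i - w i) := by
  unfold fcU
  rw [← Matrix.sub_mul, ← Matrix.mul_sub, Matrix.diagonal_sub]
  simp

lemma fcU_const {d : ℕ} (U : Matrix (Fin d) (Fin d) ℂ) (hU : U * Uᴴ = 1) (c : ℝ) :
    fcU U (fun _ => c) = (c : ℂ) • (1 : Matrix (Fin d) (Fin d) ℂ) := by
  unfold fcU
  have : diagonal (fun _ : Fin d => (c : ℂ)) = (c : ℂ) • (1 : Matrix (Fin d) (Fin d) ℂ) := by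
    rw [Matrix.smul_one_eq_diagonal]
  rw [this, Matrix.mul_smul, Matrix.mul_one, Matrix.smul_mul, hU]

lemma fcU_psd {d : ℕ} (U : Matrix (Fin d) (Fin d) ℂ) (v : Fin d → ℝ) (hv : ∀ i, 0 ≤ v i) :
    (fcU U v).PosSemidef := by
  unfold fcU
  apply Matrix.PosSemidef.mul_mul_conjTranspose_same
  rw [Matrix.posSemidef_diagonal_iff]
  intro i
  exact_mod_cast hv i

lemma fcU_herm {d : ℕ} (U : Matrix (Fin d) (Fin d) ℂ) (v : Fin d → ℝ) :
    (fcU U v).IsHermitian := by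
  unfold fcU
  apply Matrix.isHermitian_mul_mul_conjTranspose
  rw [Matrix.isHermitian_diagonal_iff]
  intro i
  simp [IsSelfAdjoint]

lemma trace_mul_fcU {d : ℕ} (U P : Matrix (Fin d) (Fin d) ℂ) (v : Fin d → ℝ) :
    (P * fcU U v).trace.re = ∑ j, ((Uᴴ * P * U) j j).re * v j := by
  have : (P * fcU U v).trace = (Uᴴ * P * U * diagonal (fun i => (v i : ℂ))).trace := by
    unfold fcU
    rw [← Matrix.mul_assoc, Matrix.trace_mul_comm]
    simp only [Matrix.mul_assoc]
  rw [this]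
  simp [Matrix.trace, Matrix.mul_diagonal]

lemma trace_fcU_mul_fcU {d : ℕ} (U : Matrix (Fin d) (Fin d) ℂ) (hU : Uᴴ * U = 1)
    (v w : Fin d → ℝ) : (fcU U v * fcU U w).trace.re = ∑ j, v j * w j := by
  rw [trace_mul_fcU]
  have : Uᴴ * fcU U v * U = diagonal (fun i => (v i : ℂ)) := by
    unfold fcU
    calc _ = (Uᴴ * U) * diagonal (fun i => (v i : ℂ)) * (Uᴴ * U) := by
          simp only [Matrix.mul_assoc]
      _ = _ := by rw [hU]; simp
  rw [this]; simp

lemma trace_fcU {d : ℕ} (U : Matrix (Fin d) (Fin d) ℂ) (hU : Uᴴ * U = 1)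
    (v : Fin d → ℝ) : (fcU U v).trace = ∑ j, (v j : ℂ) := by
  unfold fcU
  rw [Matrix.trace_mul_comm, ← Matrix.mul_assoc, hU]
  simp [Matrix.trace]

lemma eigs_fcU_sum {d : ℕ} (U : Matrix (Fin d) (Fin d) ℂ) (hU : Uᴴ * U = 1)
    (v : Fin d → ℝ) (F : ℝ → ℝ) : ∑ i, F (eigs (fcU U v) i) = ∑ i, F (v i) := by
  have h := fcU_herm U v
  have h1 := h.roots_charpoly_eq_eigenvalues
  have h2 : (fcU U v).charpoly = ∏ i, (Polynomial.X - Polynomial.C (v i : ℂ)) := by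
    unfold fcU
    rw [charpoly_mul_comm, ← Matrix.mul_assoc, hU, Matrix.one_mul, charpoly_diagonal]
  rw [h2, Polynomial.roots_prod _ _ (by
    simp [Finset.prod_ne_zero_iff, Polynomial.X_sub_C_ne_zero])] at h1
  have h3 := congrArg (fun m => (Multiset.map (fun z : ℂ => F z.re) m).sum) h1
  simp at h3
  simp only [eigs, dif_pos h]
  simp only [List.sum_ofFn, Function.comp, Complex.ofReal_re] at h3
  exact h3.symm

lemma exists_spec {d : ℕ} (A : Matrix (Fin d) (Fin d) ℂ) (hA : A.IsHermitian) :
    ∃ U : Matrix (Fin d) (Fin d) ℂ, Uᴴ * U = 1 ∧ U * Uᴴ = 1 ∧ A = fcU U (eigs A) := by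
  refine ⟨hA.eigenvectorUnitary, ?_, ?_, ?_⟩
  · exact Unitary.coe_star_mul_self hA.eigenvectorUnitary
  · exact Unitary.coe_mul_star_self hA.eigenvectorUnitary
  · conv_lhs => rw [hA.spectral_theorem]
    simp only [eigs, dif_pos hA]
    rfl

lemma key_q {d : ℕ} (A P : Matrix (Fin d) (Fin d) ℂ) (hA : A.IsHermitian) (m M : ℝ)
    (h1 : (P - (m : ℂ) • (1 : Matrix (Fin d) (Fin d) ℂ)).PosSemidef)
    (h2 : ((M : ℂ) • (1 : Matrix (Fin d) (Fin d) ℂ) - P).PosSemidef) :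
    ∃ q : Fin d → ℝ, (∀ j, m ≤ q j ∧ q j ≤ M) ∧ (P * A).trace.re = ∑ j, q j * eigs A j ∧
      P.trace.re = ∑ j, q j := by
  obtain ⟨U, hU, hU', hAU⟩ := exists_spec A hA
  refine ⟨fun j => ((Uᴴ * P * U) j j).re, fun j => ⟨?_, ?_⟩, ?_, ?_⟩
  · have := (h1.conjTranspose_mul_mul_same U).diag_nonneg (i := j)
    rw [Matrix.mul_sub, Matrix.sub_mul, Matrix.mul_smul, Matrix.smul_mul, Matrix.mul_one, hU] at this
    have := (Complex.le_def.mp this).1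
    simp at this
    exact this
  · have := (h2.conjTranspose_mul_mul_same U).diag_nonneg (i := j)
    rw [Matrix.mul_sub, Matrix.sub_mul, Matrix.mul_smul, Matrix.smul_mul, Matrix.mul_one, hU] at this
    have := (Complex.le_def.mp this).1
    simp at this
    exact this
  · conv_lhs => rw [hAU]
    exact trace_mul_fcU U P _
  · have : P.trace = (Uᴴ * P * U).trace := by
      rw [Matrix.mul_assoc, Matrix.trace_mul_comm, Matrix.mul_assoc, hU', Matrix.mul_one]
    rw [this]; simp [Matrix.trace]

lemma sum_eigs {d : ℕ} (A : Matrix (Fin d) (Fin d) ℂ) (hA : A.IsHermitian) :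
    ∑ i, eigs A i = A.trace.re := by
  obtain ⟨U, hU, hU', hAU⟩ := exists_spec A hA
  conv_rhs => rw [hAU, trace_fcU U hU]
  simp

lemma sum_eigs_sq {d : ℕ} (A : Matrix (Fin d) (Fin d) ℂ) (hA : A.IsHermitian) :
    ∑ i, eigs A i ^ 2 = (A * A).trace.re := by
  obtain ⟨U, hU, hU', hAU⟩ := exists_spec A hA
  conv_rhs => rw [hAU, trace_fcU_mul_fcU U hU]
  simp [sq]

lemma trace_diff_ge {d : ℕ} (ε : ℝ) (σ ω : MState d) (h : inBall ε σ ω)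
    (P : Matrix (Fin d) (Fin d) ℂ) (m M : ℝ) (hmM : m ≤ M)
    (h1 : (P - (m : ℂ) • (1 : Matrix (Fin d) (Fin d) ℂ)).PosSemidef)
    (h2 : ((M : ℂ) • (1 : Matrix (Fin d) (Fin d) ℂ) - P).PosSemidef) :
    -(M - m) * ε ≤ (P * ω.1).trace.re - (P * σ.1).trace.re := by
  have hA : (ω.1 - σ.1).IsHermitian := ω.2.1.1.sub σ.2.1.1
  obtain ⟨q, hq, hq1, -⟩ := key_q (ω.1 - σ.1) P hA m M h1 h2
  have hs := sum_eigs _ hA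
  rw [Matrix.trace_sub, ω.2.2, σ.2.2] at hs
  rw [Matrix.mul_sub, Matrix.trace_sub, Complex.sub_re] at hq1
  rw [hq1]
  unfold inBall traceNorm at h
  set a := eigs (ω.1 - σ.1)
  have e1 : ∑ j, q j * a j = ∑ j, (q j - (m + M) / 2) * a j := by
    simp only [sub_mul, Finset.sum_sub_distrib, ← Finset.mul_sum]
    rw [hs]; simp
  have e2 : ∑ j, -((M - m) / 2 * |a j|) ≤ ∑ j, (q j - (m + M) / 2) * a j := by
    refine Finset.sum_le_sum fun j _ => ?_
    have b : |(q j - (m + M) / 2)| ≤ (M - m) / 2 := by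
      rw [abs_le]; constructor <;> linarith [(hq j).1, (hq j).2]
    have c := mul_le_mul_of_nonneg_right b (abs_nonneg (a j))
    rw [← abs_mul] at c
    linarith [neg_abs_le ((q j - (m + M) / 2) * a j)]
  rw [Finset.sum_neg_distrib, ← Finset.mul_sum] at e2
  have := mul_le_mul_of_nonneg_left h (sub_nonneg.mpr hmM)
  rw [e1]
  linarith

lemma trace_le_pos {d : ℕ} (ω : MState d) (P : Matrix (Fin d) (Fin d) ℂ) (t : ℝ)
    (h1 : (P - ((0 : ℝ) : ℂ) • (1 : Matrix (Fin d) (Fin d) ℂ)).PosSemidef)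
    (h2 : (((1 : ℝ) : ℂ) • (1 : Matrix (Fin d) (Fin d) ℂ) - P).PosSemidef) :
    (P * ω.1).trace.re - t * P.trace.re ≤ ∑ i, max (eigs ω.1 i - t) 0 := by
  obtain ⟨q, hq, hq1, hq2⟩ := key_q ω.1 P ω.2.1.1 0 1 h1 h2
  rw [hq1, hq2, Finset.mul_sum, ← Finset.sum_sub_distrib]
  refine Finset.sum_le_sum fun j _ => ?_
  have := mul_le_mul_of_nonneg_left (le_max_left (eigs ω.1 j - t) 0) (hq j).1
  have := mul_le_mul_of_nonneg_right (hq j).2 (le_max_right (eigs ω.1 j - t) 0)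
  linarith

lemma clip_eq (l m M : ℝ) (h : m ≤ M) :
    max m (min l M) = l - max (l - M) 0 + max (m - l) 0 := by
  rcases le_total l M with h1 | h1 <;> rcases le_total m l with h2 | h2
  · rw [min_eq_left h1, max_eq_right h2, max_eq_right (by linarith), max_eq_right (by linarith)]
    ring
  · rw [min_eq_left h1, max_eq_left h2, max_eq_right (by linarith), max_eq_left (by linarith)]
    ring
  · rw [min_eq_right h1, max_eq_right h, max_eq_left (by linarith), max_eq_right (by linarith)]
    ring
  · have : l = M := by linarith
    have : m = M := by linarith
    subst this; subst l; simp

/-- Choice of the clipping levels. -/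
lemma exists_levels {d : ℕ} (hd : 1 ≤ d) (l : Fin d → ℝ) (hl : ∀ i, 0 ≤ l i)
    (hs : ∑ i, l i = 1) (ε : ℝ) (hε : 0 < ε) :
    ∃ m M δ : ℝ, 0 ≤ m ∧ m ≤ M ∧ ∑ i, max (l i - M) 0 = δ ∧ ∑ i, max (m - l i) 0 = δ ∧ δ ≤ ε ∧
      ((m = (d : ℝ)⁻¹ ∧ M = (d : ℝ)⁻¹) ∨ δ = ε) := by
  have hd0 : (0 : ℝ) < d := by exact_mod_cast hd
  have hD : ∑ i, max (l i - (d : ℝ)⁻¹) 0 = ∑ i, max ((d : ℝ)⁻¹ - l i) 0 := by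
    have : ∑ i, (max (l i - (d : ℝ)⁻¹) 0 - max ((d : ℝ)⁻¹ - l i) 0) = ∑ i, (l i - (d : ℝ)⁻¹) := by
      refine Finset.sum_congr rfl fun i _ => ?_
      have := max_zero_sub_eq_self (l i - (d : ℝ)⁻¹)
      rw [neg_sub] at this
      exact this
    rw [Finset.sum_sub_distrib, Finset.sum_sub_distrib, hs, Finset.sum_const] at this
    simp at this
    rw [mul_inv_cancel₀ hd0.ne'] at this
    linarith
  by_cases hc : ∑ i, max (l i - (d : ℝ)⁻¹) 0 ≤ ε
  · exact ⟨_, _, _, by positivity, le_rfl, rfl, hD.symm, hc, Or.inl ⟨rfl, rfl⟩⟩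
  · push Not at hc
    have hl1 : ∀ i, l i ≤ 1 := fun i => by
      rw [← hs]; exact Finset.single_le_sum (fun j _ => hl j) (Finset.mem_univ i)
    have hdi : (d : ℝ)⁻¹ ≤ 1 := by
      apply inv_le_one_of_one_le₀
      exact_mod_cast hd
    obtain ⟨M, hM, hM'⟩ := intermediate_value_Icc' (f := fun t => ∑ i, max (l i - t) 0) hdi
      (by fun_prop) (show ε ∈ _ from ⟨by
        simp only [max_eq_right (sub_nonpos.mpr (hl1 _))]
        simpa using hε.le, hc.le⟩)
    obtain ⟨m, hm, hm'⟩ := intermediate_value_Icc (f := fun t => ∑ i, max (t - l i) 0)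
      (show (0 : ℝ) ≤ (d : ℝ)⁻¹ by positivity)
      (by fun_prop) (show ε ∈ _ from ⟨by
        simp only [max_eq_right (sub_nonpos.mpr (hl _))]
        simpa using hε.le, hD ▸ hc.le⟩)
    exact ⟨m, M, ε, hm.1, hm.2.trans hM.1, hM', hm', le_rfl, Or.inr rfl⟩

/-- There is a unique state `ρ ∈ B_ε(σ)` majorized by every state in
`B_ε(σ)`; moreover `ρ` is either the completely mixed state or lies at trace distance
exactly `ε` from `σ`. -/
theorem exists_unique_majorization_minimal_state
    {d : ℕ} (hd : 1 ≤ d) (σ : MState d) (ε : ℝ) (hε : ε ∈ Set.Ioc (0 : ℝ) 1) :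
    ∃ ρ : MState d,
      (inBall ε σ ρ ∧ ∀ ω : MState d, inBall ε σ ω → Maj ρ ω) ∧
      (∀ ρ' : MState d,
        (inBall ε σ ρ' ∧ ∀ ω : MState d, inBall ε σ ω → Maj ρ' ω) → ρ' = ρ) ∧
      (ρ.1 = mixedMat d ∨ (1 / 2 : ℝ) * traceNorm (ρ.1 - σ.1) = ε) := by
  obtain ⟨U, hU, hU', hσU⟩ := exists_spec σ.1 σ.2.1.1
  set l := eigs σ.1 with hl
  have hl0 : ∀ i, 0 ≤ l i := fun i => by
    rw [hl]
    simp only [eigs, dif_pos σ.2.1.1]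
    exact σ.2.1.eigenvalues_nonneg i
  have hl1 : ∑ i, l i = 1 := by rw [hl, sum_eigs _ σ.2.1.1, σ.2.2]; simp
  obtain ⟨m, M, δ, hm0, hmM, hMδ, hmδ, hδε, hor⟩ := exists_levels hd l hl0 hl1 ε hε.1
  set r : Fin d → ℝ := fun i => max m (min (l i) M) with hr
  have hrm : ∀ i, m ≤ r i := fun i => le_max_left _ _
  have hrM : ∀ i, r i ≤ M := fun i => max_le hmM (min_le_right _ _)
  have hr' : ∀ i, r i = l i - max (l i - M) 0 + max (m - l i) 0 := fun i => clip_eq _ _ _ hmM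
  have hrs : ∑ i, r i = 1 := by
    simp only [hr', Finset.sum_add_distrib, Finset.sum_sub_distrib, hMδ, hmδ, hl1]
    ring
  let ρ : MState d := ⟨fcU U r, fcU_psd U r fun i => hm0.trans (hrm i), by
    rw [trace_fcU U hU, ← Complex.ofReal_sum, hrs]; simp⟩
  have hnorm : (1 / 2 : ℝ) * traceNorm (ρ.1 - σ.1) = δ := by
    have e : ρ.1 - σ.1 = fcU U (fun i => r i - l i) := by
      conv_lhs => rw [hσU]
      exact fcU_sub U r l
    unfold traceNorm
    rw [e, eigs_fcU_sum U hU _ (fun x => |x|)]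
    have : ∀ i, |r i - l i| = max (l i - M) 0 + max (m - l i) 0 := fun i => by
      rw [hr' i]
      rcases le_total (l i) M with h | h
      · rw [max_eq_right (sub_nonpos.mpr h)]
        simp
      · rw [max_eq_right (show m - l i ≤ 0 by linarith), max_eq_left (sub_nonneg.mpr h)]
        rw [abs_of_nonpos] <;> linarith
    simp only [this, Finset.sum_add_distrib, hMδ, hmδ]
    ring
  have hmaj : ∀ ω : MState d, inBall ε σ ω → Maj ρ ω := by
    intro ω hω
    have hω1 : ∑ i, eigs ω.1 i = 1 := by rw [sum_eigs _ ω.2.1.1, ω.2.2]; simp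
    have hρ1 : ∑ i, eigs ρ.1 i = 1 := by rw [sum_eigs _ ρ.2.1.1, ρ.2.2]; simp
    refine vMaj_of_pos _ _ (by rw [hω1, hρ1]) fun t => ?_
    have e0 : ∑ i, max (eigs ρ.1 i - t) 0 = ∑ i, max (r i - t) 0 :=
      eigs_fcU_sum U hU r (fun x => max (x - t) 0)
    rw [e0]
    rcases le_or_gt M t with htM | htM
    · apply Finset.sum_le_sum
      intro i _
      rw [max_eq_right (by linarith [hrM i])]
      exact le_max_right _ _
    rcases le_or_gt t m with htm | htm
    · calc ∑ i, max (r i - t) 0 = ∑ i, (r i - t) :=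
            Finset.sum_congr rfl fun i _ => max_eq_left (by linarith [hrm i])
        _ = ∑ i, (eigs ω.1 i - t) := by
            rw [Finset.sum_sub_distrib, Finset.sum_sub_distrib, hrs, hω1]
        _ ≤ _ := Finset.sum_le_sum fun i _ => le_max_left _ _
    · have hδ : δ = ε := by
        rcases hor with h | h
        · rw [h.1] at htm; rw [h.2] at htM; linarith
        · exact h
      set p : Fin d → ℝ := fun i => if t < l i then 1 else 0 with hp
      have hp0 : ∀ i, 0 ≤ p i := fun i => by simp only [hp]; split_ifs <;> norm_num
      have hp1 : ∀ i, p i ≤ 1 := fun i => by simp only [hp]; split_ifs <;> norm_num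
      have P1 : (fcU U p - ((0 : ℝ) : ℂ) • (1 : Matrix (Fin d) (Fin d) ℂ)).PosSemidef := by
        rw [← fcU_const U hU', fcU_sub]
        exact fcU_psd _ _ fun i => by linarith [hp0 i]
      have P2 : (((1 : ℝ) : ℂ) • (1 : Matrix (Fin d) (Fin d) ℂ) - fcU U p).PosSemidef := by
        rw [← fcU_const U hU', fcU_sub]
        exact fcU_psd _ _ fun i => by linarith [hp1 i]
      have a1 := trace_le_pos ω (fcU U p) t P1 P2
      have a2 := trace_diff_ge ε σ ω hω (fcU U p) 0 1 zero_le_one P1 P2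
      have a3 : (fcU U p * σ.1).trace.re = ∑ i, p i * l i := by
        conv_lhs => rw [hσU]
        exact trace_fcU_mul_fcU U hU p l
      have a4 : (fcU U p).trace.re = ∑ i, p i := by
        rw [trace_fcU U hU]; simp
      have a5 : ∑ i, max (r i - t) 0 = ∑ i, (p i * l i - t * p i - max (l i - M) 0) := by
        refine Finset.sum_congr rfl fun i _ => ?_
        rw [hr' i]
        simp only [hp]
        split_ifs with h
        · rw [max_eq_right (show m - l i ≤ 0 by linarith)]
          rw [max_eq_left]
          · ring
          · rcases le_total (l i) M with h' | h'
            · rw [max_eq_right (by linarith)]; linarith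
            · rw [max_eq_left (by linarith)]; linarith
        · push Not at h
          rw [max_eq_right (show l i - M ≤ 0 by linarith)]
          rw [max_eq_right]
          · ring
          · rcases le_total (l i) m with h' | h'
            · rw [max_eq_left (by linarith)]; linarith
            · rw [max_eq_right (by linarith)]; linarith
      rw [a5, Finset.sum_sub_distrib, Finset.sum_sub_distrib, hMδ, hδ, ← Finset.mul_sum, ← a4, ← a3]
      linarith
  have hball : inBall ε σ ρ := by
    unfold inBall
    rw [hnorm]
    exact hδε
  refine ⟨ρ, ⟨hball, hmaj⟩, ?_, ?_⟩
  · rintro ω ⟨hω, hω'⟩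
    have sq := sum_sq_eq _ _ (hω' ρ hball) (hmaj ω hω)
    rw [sum_eigs_sq _ ω.2.1.1, sum_eigs_sq _ ρ.2.1.1] at sq
    have b1 := trace_diff_ge ε σ ω hω ρ.1 m M hmM
      (by
        rw [← fcU_const U hU']
        show (fcU U r - _).PosSemidef
        rw [fcU_sub]
        exact fcU_psd _ _ fun i => by linarith [hrm i])
      (by
        rw [← fcU_const U hU']
        show (_ - fcU U r).PosSemidef
        rw [fcU_sub]
        exact fcU_psd _ _ fun i => by linarith [hrM i])
    have b2 : (ρ.1 * σ.1).trace.re = ∑ i, r i * l i := by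
      conv_lhs => rw [hσU]
      exact trace_fcU_mul_fcU U hU r l
    have b3 : (ρ.1 * ρ.1).trace.re = ∑ i, r i * r i := trace_fcU_mul_fcU U hU r r
    have b4 : ∑ i, r i * l i - ∑ i, r i * r i = M * δ - m * δ := by
      nth_rw 1 [← hMδ]
      rw [← hmδ, Finset.mul_sum, Finset.mul_sum, ← Finset.sum_sub_distrib, ← Finset.sum_sub_distrib]
      refine Finset.sum_congr rfl fun i _ => ?_
      rw [hr' i]
      rcases le_total (l i) M with h | h
      · rw [max_eq_right (sub_nonpos.mpr h)]
        rcases le_total (l i) m with h' | h'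
        · rw [max_eq_left (by linarith)]; ring
        · rw [max_eq_right (by linarith)]; ring
      · rw [max_eq_right (show m - l i ≤ 0 by linarith), max_eq_left (sub_nonneg.mpr h)]
        ring
    have b5 : (M - m) * δ = (M - m) * ε := by
      rcases hor with h | h
      · rw [h.1, h.2]; simp
      · rw [h]
    have b6 : (ρ.1 * ρ.1).trace.re ≤ (ρ.1 * ω.1).trace.re := by
      rw [b3]; rw [b2] at b1; linarith
    have hH : (ω.1 - ρ.1)ᴴ = ω.1 - ρ.1 := ω.2.1.1.sub ρ.2.1.1
    have b7 : ((ω.1 - ρ.1) * (ω.1 - ρ.1)).trace.re ≤ 0 := by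
      rw [Matrix.mul_sub, Matrix.sub_mul, Matrix.sub_mul]
      simp only [Matrix.trace_sub, Complex.sub_re]
      rw [Matrix.trace_mul_comm ω.1 ρ.1]
      linarith
    rw [← sum_eigs_sq _ hH] at b7
    have b8 : ∀ i, eigs (ω.1 - ρ.1) i = 0 := fun i => by
      have := (Finset.sum_eq_zero_iff_of_nonneg (fun i _ => sq_nonneg (eigs (ω.1 - ρ.1) i))).mp
        (le_antisymm b7 (Finset.sum_nonneg fun i _ => sq_nonneg _)) i (Finset.mem_univ i)
      simpa using this
    obtain ⟨V, -, -, hV⟩ := exists_spec _ hH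
    have b9 : ω.1 - ρ.1 = 0 := by
      rw [hV]
      simp [fcU, b8]
    exact Subtype.ext (sub_eq_zero.mp b9)
  · rcases hor with h | h
    · left
      have : r = fun _ => (d : ℝ)⁻¹ := by
        funext i
        exact le_antisymm (h.2 ▸ hrM i) (h.1 ▸ hrm i)
      show fcU U r = _
      rw [this, fcU_const U hU', mixedMat]
      simp
    · right
      rw [hnorm, h]
end
end

section
/- Let d ≥ 2, σ a state on ℂ^d and ε ∈ (0,1]. Then max{ S(ρ*_ε(σ)) − S(σ), S(σ) − S(ρ_{*,ε}(σ)) } ≤ AF(ε), where AF(ε) := ε log₂(d−1) + h(ε) if ε < 1 − 1/d, and AF(ε) := log₂ d if ε ≥ 1 − 1/d. Moreover, equality holds if and only if one of the following is true: (1) σ is a pure state (a rank-one projection); (2) ε < 1 − 1/d and the eigenvalues of σ, in non-increasing order, are (1−ε, ε/(d−1), …, ε/(d−1)); (3) ε ≥ 1 − 1/d and σ = (1/d)·I. -/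
open scoped BigOperators ComplexOrder

noncomputable section

/-- The binary entropy `h(ε) = −ε log₂ ε − (1−ε) log₂(1−ε)`. -/
noncomputable def binEnt (ε : ℝ) : ℝ :=
  -(ε * Real.logb 2 ε) - (1 - ε) * Real.logb 2 (1 - ε)

/-- The Audenaert–Fannes bound. -/
noncomputable def AF (d : ℕ) (ε : ℝ) : ℝ :=
  if ε < 1 - 1 / d then ε * Real.logb 2 ((d : ℝ) - 1) + binEnt ε else Real.logb 2 d

/-- A pure state: a rank-one orthogonal projection. -/
def IsPure {d : ℕ} (σ : MState d) : Prop :=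
  σ.1 * σ.1 = σ.1

def mv {d : ℕ} (δ : ℝ) (y x : Fin d) : ℝ := if x = y then 1 - δ else δ / ((d : ℝ) - 1)

lemma mv_sum {d : ℕ} (hd : 2 ≤ d) (δ : ℝ) (y : Fin d) : ∑ x, mv δ y x = 1 := by
  have h : (d : ℝ) - 1 ≠ 0 := by
    have : (2 : ℝ) ≤ d := by exact_mod_cast hd
    linarith
  have h1 : ∀ x : Fin d, mv δ y x = (if x = y then (1 - δ - δ / ((d : ℝ) - 1)) else 0) + δ / ((d : ℝ) - 1) := by
    intro x; unfold mv; split_ifs <;> ring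
  simp only [h1, Finset.sum_add_distrib, Finset.sum_ite_eq', Finset.mem_univ, if_true,
    Finset.sum_const, Finset.card_univ, Fintype.card_fin, nsmul_eq_mul]
  field_simp
  ring

def Lval (d : ℕ) (δ : ℝ) : ℝ := -((1 - δ) * Real.log (1 - δ)) - δ * Real.log (δ / ((d : ℝ) - 1))

lemma mv_ent {d : ℕ} (hd : 2 ≤ d) (δ : ℝ) (y : Fin d) :
    ∑ x, Real.negMulLog (mv δ y x) = Lval d δ := by
  have h : (d : ℝ) - 1 ≠ 0 := by
    have : (2 : ℝ) ≤ d := by exact_mod_cast hd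
    linarith
  have h1 : ∀ x : Fin d, Real.negMulLog (mv δ y x) = (if x = y then (Real.negMulLog (1 - δ) - Real.negMulLog (δ / ((d : ℝ) - 1))) else 0) + Real.negMulLog (δ / ((d : ℝ) - 1)) := by
    intro x; unfold mv; split_ifs <;> ring
  simp only [h1, Finset.sum_add_distrib, Finset.sum_ite_eq', Finset.mem_univ, if_true,
    Finset.sum_const, Finset.card_univ, Fintype.card_fin, nsmul_eq_mul]
  unfold Lval Real.negMulLog
  field_simp
  ring

lemma term_le {w p q m : ℝ} (hw : 0 ≤ w) (hp : w ≤ p) (hq : w ≤ q) (hm : 0 < m) :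
    w * (Real.log q - Real.log p) ≤ q * m - w + w * (-Real.log m) ∧
    (w * (Real.log q - Real.log p) = q * m - w + w * (-Real.log m) → q * m = w ∧ (0 < w → p = w)) := by
  rcases hw.eq_or_lt with h0 | h0
  · subst h0
    refine ⟨by simp; positivity, fun h => ?_⟩
    simp at h ⊢
    rcases h with h | h
    · exact Or.inl h
    · exact absurd h hm.ne'
  · have hp0 : 0 < p := by linarith
    have hq0 : 0 < q := by linarith
    have hz : 0 < q * m / w := by positivity
    have e1 : Real.log (q * m / w) = Real.log q + Real.log m - Real.log w := by
      rw [Real.log_div (by positivity) (by positivity), Real.log_mul (by positivity) (by positivity)]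
    have e2 : w * (q * m / w - 1) = q * m - w := by field_simp
    have l1 : Real.log w ≤ Real.log p := Real.log_le_log h0 hp
    have l2 := Real.log_le_sub_one_of_pos hz
    have l1' := mul_le_mul_of_nonneg_left l1 hw
    have l2' := mul_le_mul_of_nonneg_left l2 hw
    rw [e2, e1] at l2'
    refine ⟨by nlinarith, fun h => ⟨?_, fun _ => ?_⟩⟩
    · by_contra hne
      have : q * m / w ≠ 1 := by
        intro h; apply hne; field_simp at h; exact h
      have l3 := Real.log_lt_sub_one_of_pos hz this
      have l3' := mul_lt_mul_of_pos_left l3 h0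
      rw [e2, e1] at l3'
      nlinarith
    · by_contra hne
      have : w < p := lt_of_le_of_ne hp (Ne.symm hne)
      have l3 := Real.log_lt_log h0 this
      have l3' := mul_lt_mul_of_pos_left l3 h0
      nlinarith

lemma coupled {d : ℕ} (hd : 2 ≤ d) {p q : Fin d → ℝ} {w : Fin d → Fin d → ℝ} {δ : ℝ}
    (hδ : 0 < δ) (hδ1 : δ < 1) (hw : ∀ x y, 0 ≤ w x y) (hwp : ∀ x, ∑ y, w x y = p x)
    (hwq : ∀ y, ∑ x, w x y = q y) (hq : ∑ y, q y = 1)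
    (hL : ∑ x, ∑ y, w x y * (-Real.log (mv δ y x)) ≤ Lval d δ) :
    (∑ x, Real.negMulLog (p x) - ∑ y, Real.negMulLog (q y) ≤ Lval d δ) ∧
    (∑ x, Real.negMulLog (p x) - ∑ y, Real.negMulLog (q y) = Lval d δ →
      ∃ y, (∀ x, q x = if x = y then 1 else 0) ∧ ∀ x, p x = mv δ y x) := by
  have hdr : (0 : ℝ) < (d : ℝ) - 1 := by
    have : (2 : ℝ) ≤ d := by exact_mod_cast hd
    linarith
  have hm : ∀ y x : Fin d, 0 < mv δ y x := by
    intro y x; unfold mv; split_ifs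
    · linarith
    · positivity
  have hwlp : ∀ x y, w x y ≤ p x := fun x y => by
    rw [← hwp x]; exact Finset.single_le_sum (f := fun y => w x y) (fun y _ => hw x y) (Finset.mem_univ y)
  have hwlq : ∀ x y, w x y ≤ q y := fun x y => by
    rw [← hwq y]; exact Finset.single_le_sum (f := fun x => w x y) (fun x _ => hw x y) (Finset.mem_univ x)
  have T := fun x y => term_le (hw x y) (hwlp x y) (hwlq x y) (hm y x)
  have eL : ∑ x, Real.negMulLog (p x) - ∑ y, Real.negMulLog (q y)
      = ∑ x, ∑ y, w x y * (Real.log (q y) - Real.log (p x)) := by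
    simp only [mul_sub, Finset.sum_sub_distrib, ← Finset.sum_mul, hwp]
    rw [Finset.sum_comm]
    simp only [← Finset.sum_mul, hwq, Real.negMulLog, neg_mul, Finset.sum_neg_distrib]
    ring
  have eS : ∑ x, ∑ y, (q y * mv δ y x - w x y) = 0 := by
    rw [Finset.sum_comm]
    simp only [Finset.sum_sub_distrib, ← Finset.mul_sum, mv_sum hd, hwq]
    simp
  have eR : ∑ x, ∑ y, (q y * mv δ y x - w x y + w x y * (-Real.log (mv δ y x))) =
      ∑ x, ∑ y, w x y * (-Real.log (mv δ y x)) := by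
    simp only [Finset.sum_add_distrib] at *
    rw [eS, zero_add]
  have hle : ∑ x, ∑ y, w x y * (Real.log (q y) - Real.log (p x)) ≤
      ∑ x, ∑ y, (q y * mv δ y x - w x y + w x y * (-Real.log (mv δ y x))) :=
    Finset.sum_le_sum fun x _ => Finset.sum_le_sum fun y _ => (T x y).1
  refine ⟨by rw [eL]; linarith, fun heq => ?_⟩
  have heq2 : ∑ x, ∑ y, w x y * (Real.log (q y) - Real.log (p x)) =
      ∑ x, ∑ y, (q y * mv δ y x - w x y + w x y * (-Real.log (mv δ y x))) := by
    apply le_antisymm hle; rw [← eL]; linarith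
  have h1 := (Finset.sum_eq_sum_iff_of_le
    (fun x _ => Finset.sum_le_sum fun y _ => (T x y).1)).1 heq2
  have h2 : ∀ x y, q y * mv δ y x = w x y ∧ (0 < w x y → p x = w x y) := fun x y =>
    (T x y).2 ((Finset.sum_eq_sum_iff_of_le (fun y _ => (T x y).1)).1 (h1 x (Finset.mem_univ x)) y
      (Finset.mem_univ y))
  have hq0 : ∀ y, 0 ≤ q y := fun y => (hw y y).trans (hwlq y y)
  obtain ⟨y, hy⟩ : ∃ y, 0 < q y := by
    by_contra! hn
    have : ∑ y, q y ≤ 0 := Finset.sum_nonpos fun y _ => hn y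
    linarith
  have hwy : ∀ x, 0 < w x y := fun x => by rw [← (h2 x y).1]; exact mul_pos hy (hm y x)
  have hz : ∀ y', y' ≠ y → q y' = 0 := by
    intro y' hne
    have h3 : w y y + w y y' ≤ p y := by
      rw [← hwp y, ← Finset.sum_pair (f := fun z => w y z) hne.symm]
      exact Finset.sum_le_sum_of_subset_of_nonneg (Finset.subset_univ _) fun z _ _ => hw y z
    rw [(h2 y y).2 (hwy y)] at h3
    have h4 : w y y' = 0 := le_antisymm (by linarith) (hw _ _)
    rw [← (h2 y y').1] at h4
    exact (mul_eq_zero.1 h4).resolve_right (hm _ _).ne'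
  have hq1 : q y = 1 := by
    rw [← hq]; symm; exact Finset.sum_eq_single y (fun b _ hb => hz b hb) (by simp)
  refine ⟨y, fun x => ?_, fun x => ?_⟩
  · split_ifs with h
    · rw [h, hq1]
    · exact hz x h
  · rw [(h2 x y).2 (hwy x), ← (h2 x y).1, hq1, one_mul]

lemma classicalAF {d : ℕ} (hd : 2 ≤ d) {p q : Fin d → ℝ} {ε δ : ℝ} (hε : 0 < ε)
    (hδ : δ = min ε (1 - 1 / (d : ℝ)))
    (hp0 : ∀ x, 0 ≤ p x) (hq0 : ∀ x, 0 ≤ q x) (hp : ∑ x, p x = 1) (hq : ∑ y, q y = 1)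
    (hT : (1 / 2 : ℝ) * ∑ x, |p x - q x| ≤ ε) :
    (∑ x, Real.negMulLog (p x) - ∑ y, Real.negMulLog (q y) ≤ Lval d δ) ∧
    (∑ x, Real.negMulLog (p x) - ∑ y, Real.negMulLog (q y) = Lval d δ →
      ∃ y, (∀ x, q x = if x = y then 1 else 0) ∧ ∀ x, p x = mv δ y x) := by
  have hd2 : (2 : ℝ) ≤ d := by exact_mod_cast hd
  have hdr : (0 : ℝ) < (d : ℝ) - 1 := by linarith
  have hdi : 1 / (d : ℝ) ≤ 1 / 2 := one_div_le_one_div_of_le (by norm_num) hd2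
  have hdi0 : 0 < 1 / (d : ℝ) := by positivity
  have hδ0 : 0 < δ := by rw [hδ]; exact lt_min hε (by linarith)
  have hδle : δ ≤ 1 - 1 / (d : ℝ) := by rw [hδ]; exact min_le_right _ _
  have hδ1 : δ < 1 := by linarith
  set T := ∑ x, max (p x - q x) 0 with hTdef
  have hT2 : ∑ x, max (q x - p x) 0 = T := by
    have : ∑ x, (max (p x - q x) 0 - max (q x - p x) 0) = ∑ x, (p x - q x) := by
      apply Finset.sum_congr rfl; intro x _
      rcases le_total (p x) (q x) with h | h
      · rw [max_eq_right (by linarith), max_eq_left (by linarith)]; ring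
      · rw [max_eq_left (by linarith), max_eq_right (by linarith)]; ring
    rw [Finset.sum_sub_distrib, Finset.sum_sub_distrib, hp, hq] at this
    linarith
  have hTε : T ≤ ε := by
    have : ∑ x, |p x - q x| = T + T := by
      nth_rw 2 [← hT2]
      rw [hTdef, ← Finset.sum_add_distrib]
      apply Finset.sum_congr rfl; intro x _
      rcases le_total (p x) (q x) with h | h
      · rw [max_eq_right (by linarith), max_eq_left (by linarith), abs_of_nonpos (by linarith)]; ring
      · rw [max_eq_left (by linarith), max_eq_right (by linarith), abs_of_nonneg (by linarith)]; ring
    rw [this] at hT; linarith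
  have hT0 : 0 ≤ T := Finset.sum_nonneg fun x _ => le_max_right _ _
  let w : Fin d → Fin d → ℝ := fun x y =>
    (if x = y then min (p x) (q x) else 0) + max (p x - q x) 0 * max (q y - p y) 0 / T
  have hmm : ∀ a b : ℝ, min a b + max (a - b) 0 = a := by
    intro a b
    rcases le_total a b with h | h
    · rw [min_eq_left h, max_eq_right (by linarith)]; ring
    · rw [min_eq_right h, max_eq_left (by linarith)]; ring
  have hTz : ∀ a : Fin d → ℝ, ∑ x, max (a x) 0 = T → ∀ x, max (a x) 0 * T / T = max (a x) 0 := by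
    intro a ha x
    rcases hT0.eq_or_lt with h | h
    · rw [← h] at ha ⊢
      have := (Finset.sum_eq_zero_iff_of_nonneg (fun x _ => le_max_right (a x) 0)).1 ha x (Finset.mem_univ x)
      rw [this]; simp
    · field_simp
  have hw0 : ∀ x y, 0 ≤ w x y := by
    intro x y
    have : 0 ≤ max (p x - q x) 0 * max (q y - p y) 0 / T :=
      div_nonneg (mul_nonneg (le_max_right _ _) (le_max_right _ _)) hT0
    have h2 : 0 ≤ (if x = y then min (p x) (q x) else 0) := by
      split_ifs
      · exact le_min (hp0 x) (hq0 x)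
      · rfl
    exact add_nonneg h2 this
  have hwp : ∀ x, ∑ y, w x y = p x := by
    intro x
    simp only [w, Finset.sum_add_distrib, ← Finset.sum_div, ← Finset.mul_sum, hT2]
    rw [hTz (fun x => p x - q x) rfl x]
    simp [hmm]
  have hwq : ∀ y, ∑ x, w x y = q y := by
    intro x
    simp only [w, Finset.sum_add_distrib, ← Finset.sum_div, ← Finset.sum_mul]
    rw [← hTdef, mul_comm T, hTz (fun x => q x - p x) hT2 x]
    simp [min_comm (p x) (q x), hmm]
  have hdiag : ∀ x, w x x = min (p x) (q x) := by
    intro x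
    have : max (p x - q x) 0 * max (q x - p x) 0 = 0 := by
      rcases le_total (p x) (q x) with h | h
      · rw [max_eq_right (a := p x - q x) (by linarith)]; ring
      · rw [max_eq_right (a := q x - p x) (by linarith)]; ring
    simp [w, this]
  refine coupled hd hδ0 hδ1 hw0 hwp hwq hq ?_
  have hsd : ∑ x, w x x = 1 - T := by
    have : ∑ x, (min (p x) (q x) + max (p x - q x) 0) = 1 := by
      rw [← hp]; exact Finset.sum_congr rfl fun x _ => hmm _ _
    rw [Finset.sum_add_distrib] at this
    simp only [hdiag]; linarith
  set A := -Real.log (1 - δ) with hA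
  set B := -Real.log (δ / ((d : ℝ) - 1)) with hB
  have e1 : ∀ x y, w x y * (-Real.log (mv δ y x)) = w x y * B + (if x = y then w x y * (A - B) else 0) := by
    intro x y; unfold mv; split_ifs <;> ring
  have e2 : ∑ x, ∑ y, w x y * (-Real.log (mv δ y x)) = B + (1 - T) * (A - B) := by
    simp only [e1, Finset.sum_add_distrib, ← Finset.sum_mul, hwp, Finset.sum_ite_eq, Finset.mem_univ,
      if_true, hp, hsd]
    ring
  have e3 : Lval d δ = (1 - δ) * A + δ * B := by unfold Lval; rw [hA, hB]; ring
  rw [e2, e3]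
  have hAB : A ≤ B := by
    rw [hA, hB]
    apply neg_le_neg
    apply Real.log_le_log (by positivity)
    rw [div_le_iff₀ hdr]
    have : 1 / (d : ℝ) * d = 1 := by field_simp
    nlinarith
  rcases le_total ε (1 - 1 / (d : ℝ)) with h | h
  · rw [min_eq_left h] at hδ
    nlinarith
  · rw [min_eq_right h] at hδ
    have : A = B := by
      rw [hA, hB, hδ]; congr 2; field_simp; ring
    rw [this]; linarith

open Matrix in
lemma perm_of_ds {d : ℕ} {D : Fin d → Fin d → ℝ} {p q : Fin d → ℝ}
    (hr : ∀ i, ∑ j, D i j = 1) (hc : ∀ j, ∑ i, D i j = 1)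
    (h : ∀ i j, D i j ≠ 0 → p i = q j) : ∃ π : Equiv.Perm (Fin d), ∀ i, p i = q (π i) := by
  classical
  have key : ∀ c : ℝ, Fintype.card {i // p i = c} = Fintype.card {j // q j = c} := by
    intro c
    have e1 : ((Finset.univ.filter fun i => p i = c).card : ℝ) =
        ∑ i, ∑ j, if p i = c ∧ q j = c then D i j else 0 := by
      rw [Finset.card_filter]
      push_cast
      apply Finset.sum_congr rfl
      intro i _
      by_cases hi : p i = c
      · simp only [hi, if_true, true_and]
        rw [← hr i]
        apply Finset.sum_congr rfl
        intro j _
        split_ifs with hj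
        · rfl
        · by_contra hne
          exact hj (by rw [← h i j hne, hi])
      · simp [hi]
    have e2 : ((Finset.univ.filter fun j => q j = c).card : ℝ) =
        ∑ i, ∑ j, if p i = c ∧ q j = c then D i j else 0 := by
      rw [Finset.card_filter, Finset.sum_comm]
      push_cast
      apply Finset.sum_congr rfl
      intro j _
      by_cases hj : q j = c
      · simp only [hj, if_true, and_true]
        rw [← hc j]
        apply Finset.sum_congr rfl
        intro i _
        split_ifs with hi
        · rfl
        · by_contra hne
          exact hi (by rw [h i j hne, hj])
      · simp [hj]
    rw [Fintype.card_subtype, Fintype.card_subtype]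
    exact_mod_cast e1.trans e2.symm
  let e : ∀ c, {i // p i = c} ≃ {j // q j = c} := fun c => Fintype.equivOfCardEq (key c)
  refine ⟨Equiv.ofFiberEquiv e, fun i => ?_⟩
  exact (Equiv.ofFiberEquiv_map e i).symm

def cj {d : ℕ} (V : Matrix (Fin d) (Fin d) ℂ) (q : Fin d → ℝ) : Matrix (Fin d) (Fin d) ℂ :=
  V * Matrix.diagonal (fun i => (q i : ℂ)) * V.conjTranspose

open Matrix

lemma cj_herm {d : ℕ} (V : Matrix (Fin d) (Fin d) ℂ) (q : Fin d → ℝ) : (cj V q).IsHermitian := by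
  unfold cj
  apply Matrix.isHermitian_mul_mul_conjTranspose
  rw [Matrix.isHermitian_diagonal_iff]
  intro i
  simp [IsSelfAdjoint]

lemma spec {d : ℕ} {A : Matrix (Fin d) (Fin d) ℂ} (hA : A.IsHermitian) :
    ∃ V : Matrix (Fin d) (Fin d) ℂ, V * Vᴴ = 1 ∧ Vᴴ * V = 1 ∧ A = cj V (eigs A) := by
  refine ⟨hA.eigenvectorUnitary, ?_, ?_, ?_⟩
  · exact Unitary.coe_mul_star_self hA.eigenvectorUnitary
  · exact Unitary.coe_star_mul_self hA.eigenvectorUnitary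
  · conv_lhs => rw [hA.spectral_theorem, Unitary.conjStarAlgAut_apply]
    simp only [cj, eigs, hA, dif_pos]
    rfl

lemma ds_of_unitary {d : ℕ} {U : Matrix (Fin d) (Fin d) ℂ} (h1 : U * Uᴴ = 1) (h2 : Uᴴ * U = 1) :
    (∀ i, ∑ j, Complex.normSq (U i j) = 1) ∧ (∀ j, ∑ i, Complex.normSq (U i j) = 1) := by
  constructor
  · intro i
    have := congrFun (congrFun h1 i) i
    simp only [mul_apply, conjTranspose_apply, one_apply_eq] at this
    have h3 : ((∑ j, Complex.normSq (U i j) : ℝ) : ℂ) = 1 := by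
      rw [← this]; push_cast
      exact Finset.sum_congr rfl fun j _ => (Complex.mul_conj _).symm
    exact_mod_cast h3
  · intro i
    have := congrFun (congrFun h2 i) i
    simp only [mul_apply, conjTranspose_apply, one_apply_eq] at this
    have h3 : ((∑ j, Complex.normSq (U j i) : ℝ) : ℂ) = 1 := by
      rw [← this]; push_cast
      exact Finset.sum_congr rfl fun j _ => by rw [mul_comm]; exact (Complex.mul_conj _).symm
    exact_mod_cast h3

/-- Doubly stochastic representation of the diagonal in another orthonormal basis. -/
lemma pinch {d : ℕ} {A W : Matrix (Fin d) (Fin d) ℂ} (hA : A.IsHermitian)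
    (h1 : W * Wᴴ = 1) (h2 : Wᴴ * W = 1) :
    ∃ D : Fin d → Fin d → ℝ, (∀ i j, 0 ≤ D i j) ∧ (∀ i, ∑ j, D i j = 1) ∧
      (∀ j, ∑ i, D i j = 1) ∧ (∀ i, ((Wᴴ * A * W) i i).re = ∑ j, D i j * eigs A j) ∧
      (∀ q : Fin d → ℝ, A = cj W q → ∀ i j, D i j ≠ 0 → q i = eigs A j) := by
  obtain ⟨V, v1, v2, hV⟩ := spec hA
  set U := Wᴴ * V with hU
  have u1 : U * Uᴴ = 1 := by
    rw [hU, conjTranspose_mul, conjTranspose_conjTranspose, Matrix.mul_assoc, ← Matrix.mul_assoc V, v1,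
      Matrix.one_mul, h2]
  have u2 : Uᴴ * U = 1 := by
    rw [hU, conjTranspose_mul, conjTranspose_conjTranspose, Matrix.mul_assoc, ← Matrix.mul_assoc W, h1,
      Matrix.one_mul, v2]
  have hds := ds_of_unitary u1 u2
  refine ⟨fun i j => Complex.normSq (U i j), fun i j => Complex.normSq_nonneg _, hds.1, hds.2, ?_, ?_⟩
  · intro i
    have e : Wᴴ * A * W = cj U (eigs A) := by
      conv_lhs => rw [hV]
      simp only [cj, hU, conjTranspose_mul, conjTranspose_conjTranspose, Matrix.mul_assoc]
    rw [e, cj, mul_apply]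
    simp only [mul_diagonal, conjTranspose_apply, Complex.re_sum]
    apply Finset.sum_congr rfl
    intro j _
    have : U i j * (eigs A j : ℂ) * star (U i j) = ((Complex.normSq (U i j) * eigs A j : ℝ) : ℂ) := by
      push_cast
      rw [← Complex.mul_conj]
      simp only [Complex.star_def]
      ring
    rw [this, Complex.ofReal_re]
  · intro q hq i j hD
    have e : Matrix.diagonal (fun i => (q i : ℂ)) * U = U * Matrix.diagonal (fun i => (eigs A i : ℂ)) := by
      have e1 : Wᴴ * A * V = Matrix.diagonal (fun i => (q i : ℂ)) * U := by
        rw [hq, cj, hU]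
        simp only [← Matrix.mul_assoc]
        rw [h2, Matrix.one_mul]
      have e2 : Wᴴ * A * V = U * Matrix.diagonal (fun i => (eigs A i : ℂ)) := by
        conv_lhs => rw [hV]
        rw [cj, hU]
        simp only [Matrix.mul_assoc]
        rw [v2, Matrix.mul_one]
      rw [← e1, e2]
    have := congrFun (congrFun e i) j
    rw [diagonal_mul, mul_diagonal, mul_comm] at this
    have hne : U i j ≠ 0 := fun h => hD (by simp [h])
    exact_mod_cast mul_left_cancel₀ hne this

lemma eigs_cj {d : ℕ} {W : Matrix (Fin d) (Fin d) ℂ} (h1 : W * Wᴴ = 1) (h2 : Wᴴ * W = 1)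
    (q : Fin d → ℝ) : ∃ π : Equiv.Perm (Fin d), ∀ i, eigs (cj W q) (π i) = q i := by
  obtain ⟨D, _, hr, hc, _, h⟩ := pinch (cj_herm W q) h1 h2
  obtain ⟨π, hπ⟩ := perm_of_ds hr hc (h q rfl)
  exact ⟨π, fun i => (hπ i).symm⟩

lemma traceNorm_cj {d : ℕ} {W : Matrix (Fin d) (Fin d) ℂ} (h1 : W * Wᴴ = 1) (h2 : Wᴴ * W = 1)
    (q : Fin d → ℝ) : traceNorm (cj W q) = ∑ i, |q i| := by
  obtain ⟨π, hπ⟩ := eigs_cj h1 h2 q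
  unfold traceNorm
  rw [← Equiv.sum_comp π]
  exact Finset.sum_congr rfl fun i _ => by rw [hπ]

lemma cj_sub {d : ℕ} (W : Matrix (Fin d) (Fin d) ℂ) (p q : Fin d → ℝ) :
    cj W p - cj W q = cj W (fun i => p i - q i) := by
  simp only [cj, ← Matrix.sub_mul, ← Matrix.mul_sub, Matrix.diagonal_sub]
  simp

lemma traceNorm_sub_comm {d : ℕ} {A B : Matrix (Fin d) (Fin d) ℂ} (hA : A.IsHermitian)
    (hB : B.IsHermitian) : traceNorm (A - B) = traceNorm (B - A) := by
  obtain ⟨V, v1, v2, hV⟩ := spec (hA.sub hB)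
  have : B - A = cj V (fun i => - eigs (A - B) i) := by
    rw [← neg_sub A B]
    conv_lhs => rw [hV]
    simp [cj, ← Matrix.diagonal_neg]
  rw [this, traceNorm_cj v1 v2]
  simp [traceNorm]

lemma cj_diag {d : ℕ} {W : Matrix (Fin d) (Fin d) ℂ} (h2 : Wᴴ * W = 1)
    (q : Fin d → ℝ) (i : Fin d) : ((Wᴴ * cj W q * W) i i).re = q i := by
  have : Wᴴ * cj W q * W = Matrix.diagonal (fun i => (q i : ℂ)) := by
    rw [cj]; simp only [Matrix.mul_assoc]; rw [h2, Matrix.mul_one, ← Matrix.mul_assoc, h2, Matrix.one_mul]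
  rw [this]; simp

lemma cj_trace {d : ℕ} {W : Matrix (Fin d) (Fin d) ℂ} (h2 : Wᴴ * W = 1)
    (q : Fin d → ℝ) : (cj W q).trace = ((∑ i, q i : ℝ) : ℂ) := by
  rw [cj, Matrix.trace_mul_comm, ← Matrix.mul_assoc, h2, Matrix.one_mul, Matrix.trace_diagonal]
  simp

lemma eigs_nonneg {d : ℕ} (σ : MState d) (i : Fin d) : 0 ≤ eigs σ.1 i := by
  have := σ.2.1.isHermitian
  simp only [eigs, this, dif_pos]
  exact σ.2.1.eigenvalues_nonneg i

lemma eigs_sum {d : ℕ} (σ : MState d) : ∑ i, eigs σ.1 i = 1 := by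
  obtain ⟨V, v1, v2, hV⟩ := spec σ.2.1.isHermitian
  have := cj_trace v2 (eigs σ.1)
  rw [← hV, σ.2.2] at this
  exact_mod_cast this.symm

def mkState {d : ℕ} (W : Matrix (Fin d) (Fin d) ℂ) (h2 : Wᴴ * W = 1) (q : Fin d → ℝ)
    (hq : ∀ i, 0 ≤ q i) (hs : ∑ i, q i = 1) : MState d :=
  ⟨cj W q, by
    constructor
    · apply Matrix.PosSemidef.mul_mul_conjTranspose_same
      apply Matrix.PosSemidef.diagonal
      intro i
      simpa using hq i
    · rw [cj_trace h2, hs]; simp⟩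

lemma vnEnt_eq {d : ℕ} (ρ : MState d) : vnEnt ρ = (∑ i, Real.negMulLog (eigs ρ.1 i)) / Real.log 2 := by
  unfold vnEnt Real.logb Real.negMulLog
  rw [Finset.sum_div, ← Finset.sum_neg_distrib]
  exact Finset.sum_congr rfl fun i _ => by ring

/-- Entropy does not decrease under pinching. -/
lemma pinch_ent {d : ℕ} {W : Matrix (Fin d) (Fin d) ℂ} (h1 : W * Wᴴ = 1) (h2 : Wᴴ * W = 1)
    (ρ : MState d) :
    (∀ i, 0 ≤ ((Wᴴ * ρ.1 * W) i i).re) ∧ ∑ i, ((Wᴴ * ρ.1 * W) i i).re = 1 ∧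
    ∑ i, Real.negMulLog (eigs ρ.1 i) ≤ ∑ i, Real.negMulLog ((Wᴴ * ρ.1 * W) i i).re ∧
    (∑ i, Real.negMulLog (eigs ρ.1 i) = ∑ i, Real.negMulLog ((Wᴴ * ρ.1 * W) i i).re →
      ∃ π : Equiv.Perm (Fin d), ∀ i, ((Wᴴ * ρ.1 * W) i i).re = eigs ρ.1 (π i)) := by
  obtain ⟨D, hD0, hr, hc, hd, _⟩ := pinch ρ.2.1.isHermitian h1 h2
  have h0 := eigs_nonneg ρ
  have jen : ∀ i, ∑ j, D i j * Real.negMulLog (eigs ρ.1 j) ≤ Real.negMulLog ((Wᴴ * ρ.1 * W) i i).re := by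
    intro i
    rw [hd]
    have := Real.concaveOn_negMulLog.le_map_sum (t := Finset.univ) (w := D i) (p := eigs ρ.1)
      (fun j _ => hD0 i j) (hr i) (fun j _ => h0 j)
    simpa using this
  have es : ∑ i, Real.negMulLog (eigs ρ.1 i) = ∑ i, ∑ j, D i j * Real.negMulLog (eigs ρ.1 j) := by
    rw [Finset.sum_comm]
    simp only [← Finset.sum_mul, hc, one_mul]
  refine ⟨fun i => ?_, ?_, ?_, fun heq => ?_⟩
  · rw [hd]; exact Finset.sum_nonneg fun j _ => mul_nonneg (hD0 i j) (h0 j)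
  · simp only [hd]
    rw [Finset.sum_comm]
    simp only [← Finset.sum_mul, hc, one_mul, eigs_sum]
  · rw [es]; exact Finset.sum_le_sum fun i _ => jen i
  · rw [es] at heq
    have hi := (Finset.sum_eq_sum_iff_of_le (fun i _ => jen i)).1 heq
    refine perm_of_ds hr hc fun i j hne => ?_
    have h3 := hi i (Finset.mem_univ i)
    rw [hd] at h3 ⊢
    have h4 := Real.strictConcaveOn_negMulLog.map_sum_eq_iff' (t := Finset.univ) (w := D i) (p := eigs ρ.1)
      (fun j _ => hD0 i j) (hr i) (fun j _ => h0 j)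
    simp only [smul_eq_mul] at h4
    exact (h4.1 h3.symm j (Finset.mem_univ j) hne).symm

lemma pinch_traceNorm {d : ℕ} {A W : Matrix (Fin d) (Fin d) ℂ} (hA : A.IsHermitian)
    (h1 : W * Wᴴ = 1) (h2 : Wᴴ * W = 1) : ∑ i, |((Wᴴ * A * W) i i).re| ≤ traceNorm A := by
  obtain ⟨D, hD0, hr, hc, hd, _⟩ := pinch hA h1 h2
  have : traceNorm A = ∑ i, ∑ j, D i j * |eigs A j| := by
    rw [Finset.sum_comm]
    simp only [← Finset.sum_mul, hc, one_mul, traceNorm]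
  rw [this]
  apply Finset.sum_le_sum
  intro i _
  rw [hd]
  refine (Finset.abs_sum_le_sum_abs _ _).trans (le_of_eq ?_)
  exact Finset.sum_congr rfl fun j _ => by rw [abs_mul, abs_of_nonneg (hD0 i j)]

lemma quantumAF {d : ℕ} (hd : 2 ≤ d) {ε δ : ℝ} (hε : 0 < ε) (hδ : δ = min ε (1 - 1 / (d : ℝ)))
    (ρ σ : MState d) (hb : (1 / 2 : ℝ) * traceNorm (ρ.1 - σ.1) ≤ ε) :
    vnEnt ρ - vnEnt σ ≤ Lval d δ / Real.log 2 ∧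
    (vnEnt ρ - vnEnt σ = Lval d δ / Real.log 2 →
      (∃ y, ∀ x, eigs σ.1 x = if x = y then 1 else 0) ∧ ∃ y, ∀ x, eigs ρ.1 x = mv δ y x) := by
  obtain ⟨W, h1, h2, hW⟩ := spec σ.2.1.isHermitian
  obtain ⟨p0, p1, pe, pq⟩ := pinch_ent h1 h2 ρ
  have hl : 0 < Real.log 2 := Real.log_pos (by norm_num)
  have hn := pinch_traceNorm (ρ.2.1.isHermitian.sub σ.2.1.isHermitian) h1 h2
  have hdg : ∀ i, ((Wᴴ * σ.1 * W) i i).re = eigs σ.1 i := fun i => by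
    conv_lhs => rw [hW]
    exact cj_diag h2 _ i
  have hn2 : ∑ i, |((Wᴴ * ρ.1 * W) i i).re - eigs σ.1 i| ≤ traceNorm (ρ.1 - σ.1) := by
    refine le_trans (le_of_eq ?_) hn
    apply Finset.sum_congr rfl
    intro i _
    rw [Matrix.mul_sub, Matrix.sub_mul, Matrix.sub_apply, Complex.sub_re, hdg]
  obtain ⟨c1, c2⟩ := classicalAF hd hε hδ p0 (eigs_nonneg σ) p1 (eigs_sum σ) (by linarith)
  rw [vnEnt_eq, vnEnt_eq, ← sub_div, div_left_inj' hl.ne', div_le_div_iff_of_pos_right hl]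
  refine ⟨by linarith, fun heq => ?_⟩
  obtain ⟨y, hy1, hy2⟩ := c2 (by linarith)
  obtain ⟨π, hπ⟩ := pq (by linarith)
  refine ⟨⟨y, hy1⟩, π y, fun x => ?_⟩
  have := hπ (π.symm x)
  rw [hy2, Equiv.apply_symm_apply] at this
  rw [← this]
  simp only [mv, Equiv.symm_apply_eq]

lemma AF_eq {d : ℕ} (hd : 2 ≤ d) {ε δ : ℝ} (hε : 0 < ε) (hδ : δ = min ε (1 - 1 / (d : ℝ))) :
    AF d ε = Lval d δ / Real.log 2 := by
  have hd2 : (2 : ℝ) ≤ d := by exact_mod_cast hd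
  have hdr : (0 : ℝ) < (d : ℝ) - 1 := by linarith
  unfold AF Lval
  split_ifs with h
  · rw [min_eq_left h.le] at hδ
    subst hδ
    unfold binEnt Real.logb
    rw [Real.log_div hε.ne' hdr.ne']
    ring
  · rw [min_eq_right (not_lt.1 h)] at hδ
    have e1 : 1 - δ = 1 / d := by rw [hδ]; ring
    have e2 : δ / ((d : ℝ) - 1) = 1 / d := by rw [hδ]; field_simp
    rw [e2, e1, Real.logb, one_div, Real.log_inv, hδ]
    congr 1
    ring

lemma kbdd {d : ℕ} (v : Fin d → ℝ) (s : Finset (Fin d)) : ∑ i ∈ s, v i ≤ kMaxSum v s.card := by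
  apply le_csSup
  · exact (Set.toFinite _).bddAbove
  · exact ⟨s, rfl, rfl⟩

lemma kle {d : ℕ} (v : Fin d → ℝ) {k : ℕ} (hk : k ≤ d) {c : ℝ}
    (h : ∀ s : Finset (Fin d), s.card = k → ∑ i ∈ s, v i ≤ c) : kMaxSum v k ≤ c := by
  apply csSup_le
  · obtain ⟨s, _, hs⟩ := Finset.exists_subset_card_eq (s := (Finset.univ : Finset (Fin d))) (n := k) (by simpa using hk)
    exact ⟨_, s, hs, rfl⟩
  · rintro _ ⟨s, hs, rfl⟩
    exact h s hs

lemma le_of_maj {d : ℕ} (hd : 2 ≤ d) {ρ ω : MState d} (h : Maj ρ ω) {a : ℝ} (ha : ∀ i, eigs ω.1 i ≤ a)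
    (i : Fin d) : eigs ρ.1 i ≤ a := by
  have h1 := h.1 1 le_rfl (by omega)
  have h2 := kbdd (eigs ρ.1) {i}
  simp only [Finset.sum_singleton, Finset.card_singleton] at h2
  refine h2.trans (h1.trans (kle _ (by omega) fun s hs => ?_))
  obtain ⟨j, rfl⟩ := Finset.card_eq_one.1 hs
  simpa using ha j

lemma ge_of_maj {d : ℕ} (hd : 2 ≤ d) {ρ ω : MState d} (h : Maj ρ ω) {b : ℝ} (hb : ∀ i, b ≤ eigs ω.1 i)
    (i : Fin d) : b ≤ eigs ρ.1 i := by
  have h1 := h.1 (d - 1) (by omega) (by omega)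
  have h2 := kbdd (eigs ρ.1) (Finset.univ.erase i)
  rw [Finset.card_erase_of_mem (Finset.mem_univ i), Finset.card_univ, Fintype.card_fin] at h2
  have h3 : kMaxSum (eigs ω.1) (d - 1) ≤ 1 - b := by
    refine kle _ (by omega) fun s hs => ?_
    have hsc : sᶜ.card = 1 := by rw [Finset.card_compl, Fintype.card_fin]; omega
    obtain ⟨j, hj⟩ := Finset.card_eq_one.1 hsc
    have := Finset.sum_add_sum_compl s (eigs ω.1)
    rw [hj, Finset.sum_singleton, eigs_sum] at this
    linarith [hb j]
  have h4 := Finset.add_sum_erase Finset.univ (eigs ρ.1) (Finset.mem_univ i)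
  rw [eigs_sum] at h4
  linarith

lemma chord {a b x : ℝ} (hb : 0 ≤ b) (hx1 : b ≤ x) (hx2 : x ≤ a) :
    Real.negMulLog b + (Real.negMulLog a - Real.negMulLog b) / (a - b) * (x - b) ≤ Real.negMulLog x := by
  rcases (hx1.trans hx2).eq_or_lt with h | h
  · have : x = b := by linarith
    subst this; simp
  · have hab : 0 < a - b := by linarith
    have ha1 : 0 ≤ (a - x) / (a - b) := div_nonneg (by linarith) hab.le
    have ha2 : 0 ≤ (x - b) / (a - b) := div_nonneg (by linarith) hab.le
    have ha3 : (a - x) / (a - b) + (x - b) / (a - b) = 1 := by field_simp; ring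
    have hbm : b ∈ Set.Ici (0 : ℝ) := hb
    have ham : a ∈ Set.Ici (0 : ℝ) := hb.trans h.le
    have := Real.concaveOn_negMulLog.2 hbm ham ha1 ha2 ha3
    simp only [smul_eq_mul] at this
    have e : (a - x) / (a - b) * b + (x - b) / (a - b) * a = x := by field_simp; ring
    rw [e] at this
    refine le_trans (le_of_eq ?_) this
    field_simp
    ring

/-- Entropy lower bound for a vector majorized by a two-level vector. -/
lemma ent_ge {d : ℕ} (hd : 2 ≤ d) {δ : ℝ} (hδ0 : 0 ≤ δ) {p : Fin d → ℝ} (hp : ∑ i, p i = 1)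
    (h1 : ∀ i, p i ≤ 1 - δ) (h2 : ∀ i, δ / ((d : ℝ) - 1) ≤ p i) :
    Lval d δ ≤ ∑ i, Real.negMulLog (p i) := by
  have hd2 : (2 : ℝ) ≤ d := by exact_mod_cast hd
  have hdr : (0 : ℝ) < (d : ℝ) - 1 := by linarith
  set b := δ / ((d : ℝ) - 1) with hb
  have hb0 : 0 ≤ b := by positivity
  let y : Fin d := ⟨0, by omega⟩
  rw [← mv_ent hd δ y]
  set m := (Real.negMulLog (1 - δ) - Real.negMulLog b) / (1 - δ - b) with hm
  have hba : b ≤ 1 - δ := (h2 y).trans (h1 y)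
  have e1 : ∑ x, Real.negMulLog (mv δ y x) = ∑ x : Fin d, (Real.negMulLog b + m * (mv δ y x - b)) := by
    apply Finset.sum_congr rfl
    intro x _
    unfold mv
    split_ifs
    · rcases hba.eq_or_lt with h | h
      · rw [← h]; simp
      · have : 1 - δ - b ≠ 0 := by linarith
        rw [hm]; field_simp; ring
    · simp [← hb]
  have e2 : ∑ x : Fin d, (Real.negMulLog b + m * (mv δ y x - b)) =
      ∑ x : Fin d, (Real.negMulLog b + m * (p x - b)) := by
    simp only [Finset.sum_add_distrib, ← Finset.mul_sum, Finset.sum_sub_distrib, mv_sum hd, hp]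
  rw [e1, e2]
  exact Finset.sum_le_sum fun i _ => chord hb0 (h2 i) (h1 i)

lemma cj_mul {d : ℕ} {W : Matrix (Fin d) (Fin d) ℂ} (h2 : Wᴴ * W = 1)
    (p q : Fin d → ℝ) : cj W p * cj W q = cj W (fun i => p i * q i) := by
  simp only [cj]
  have : ∀ a b : Matrix (Fin d) (Fin d) ℂ, W * a * Wᴴ * (W * b * Wᴴ) = W * (a * b) * Wᴴ := by
    intro a b
    calc _ = W * a * (Wᴴ * W) * b * Wᴴ := by simp only [Matrix.mul_assoc]
      _ = _ := by rw [h2]; simp only [Matrix.mul_assoc, Matrix.one_mul]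
  rw [this, Matrix.diagonal_mul_diagonal]
  simp

lemma pure_iff {d : ℕ} (σ : MState d) :
    IsPure σ ↔ ∃ y, ∀ x, eigs σ.1 x = if x = y then 1 else 0 := by
  obtain ⟨W, h1, h2, hW⟩ := spec σ.2.1.isHermitian
  unfold IsPure
  constructor
  · intro h
    have hsq : ∀ i, eigs σ.1 i * eigs σ.1 i = eigs σ.1 i := by
      intro i
      have h3 : cj W (fun i => eigs σ.1 i * eigs σ.1 i) = cj W (eigs σ.1) := by
        rw [← cj_mul h2, ← hW, h]
      rw [← cj_diag h2 (fun i => eigs σ.1 i * eigs σ.1 i) i, h3, cj_diag h2]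
    have h01 : ∀ i, eigs σ.1 i = 0 ∨ eigs σ.1 i = 1 := by
      intro i
      rcases eq_or_ne (eigs σ.1 i) 0 with h | h
      · exact Or.inl h
      · exact Or.inr (mul_left_cancel₀ h (by rw [hsq, mul_one]))
    have hs := eigs_sum σ
    obtain ⟨y, hy⟩ : ∃ y, eigs σ.1 y = 1 := by
      by_contra! hn
      rw [Finset.sum_eq_zero fun i _ => (h01 i).resolve_right (hn i)] at hs
      exact zero_ne_one hs
    refine ⟨y, fun x => ?_⟩
    split_ifs with hx
    · rw [hx, hy]
    · have h4 := Finset.add_sum_erase Finset.univ (eigs σ.1) (Finset.mem_univ y)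
      rw [hs, hy] at h4
      have h5 : ∑ i ∈ Finset.univ.erase y, eigs σ.1 i = 0 := by linarith
      exact (Finset.sum_eq_zero_iff_of_nonneg fun i _ => eigs_nonneg σ i).1 h5 x
        (Finset.mem_erase.2 ⟨hx, Finset.mem_univ x⟩)
  · rintro ⟨y, hy⟩
    rw [hW, cj_mul h2]
    congr 1
    funext i
    rw [hy]; split_ifs <;> simp

lemma mixed_iff {d : ℕ} (σ : MState d) : σ.1 = mixedMat d ↔ ∀ x, eigs σ.1 x = 1 / (d : ℝ) := by
  obtain ⟨W, h1, h2, hW⟩ := spec σ.2.1.isHermitian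
  have key : mixedMat d = cj W (fun _ => 1 / (d : ℝ)) := by
    have : Matrix.diagonal (fun _ : Fin d => (((1 / (d : ℝ) : ℝ)) : ℂ)) = ((d : ℂ)⁻¹) • 1 := by
      rw [← Matrix.diagonal_one, ← Matrix.diagonal_smul]
      congr 1; funext i; simp
    rw [mixedMat, cj, this]
    simp [h1]
  constructor
  · intro h x
    have h3 := cj_diag h2 (eigs σ.1) x
    rw [← hW, h, key, cj_diag h2] at h3
    rw [h, key]; exact h3.symm
  · intro h
    rw [hW, key]; congr 1; funext x; exact h x

lemma cases_iff {d : ℕ} (hd : 2 ≤ d) {ε δ : ℝ} (hδ : δ = min ε (1 - 1 / (d : ℝ))) (σ : MState d) :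
    ((ε < 1 - 1 / d ∧ ∃ π : Equiv.Perm (Fin d), ∀ i : Fin d,
          eigs σ.1 (π i) = if (i : ℕ) = 0 then 1 - ε else ε / ((d : ℝ) - 1)) ∨
       (1 - 1 / d ≤ ε ∧ σ.1 = mixedMat d)) ↔ ∃ y, ∀ x, eigs σ.1 x = mv δ y x := by
  have hd2 : (2 : ℝ) ≤ d := by exact_mod_cast hd
  have hdr : (0 : ℝ) < (d : ℝ) - 1 := by linarith
  let z : Fin d := ⟨0, by omega⟩
  have hz : ∀ i : Fin d, (i : ℕ) = 0 ↔ i = z := fun i => by simp [z, Fin.ext_iff]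
  rcases lt_or_ge ε (1 - 1 / (d : ℝ)) with h | h
  · rw [min_eq_left h.le] at hδ
    subst hδ
    simp only [h, true_and, not_le.2 h, false_and, or_false, hz]
    constructor
    · rintro ⟨π, hπ⟩
      refine ⟨π z, fun x => ?_⟩
      have := hπ (π.symm x)
      rw [Equiv.apply_symm_apply] at this
      rw [this]; simp only [mv, Equiv.symm_apply_eq]
    · rintro ⟨y, hy⟩
      refine ⟨Equiv.swap z y, fun i => ?_⟩
      rw [hy, mv]
      have : Equiv.swap z y i = y ↔ i = z := by
        rw [← Equiv.eq_symm_apply]; simp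
      simp only [this]
  · rw [min_eq_right h] at hδ
    simp only [h, true_and, not_lt.2 h, false_and, false_or, mixed_iff]
    have e : ∀ y x : Fin d, mv δ y x = 1 / d := by
      intro y x; unfold mv; rw [hδ]; split_ifs
      · ring
      · field_simp
    simp only [e]
    exact ⟨fun h => ⟨z, h⟩, fun ⟨_, h⟩ => h⟩

lemma mv_dist {d : ℕ} (hd : 2 ≤ d) {δ : ℝ} (h0 : 0 ≤ δ) (y : Fin d) :
    (1 / 2 : ℝ) * ∑ i, |mv δ y i - (if i = y then 1 else 0)| = δ := by
  have hd2 : (2 : ℝ) ≤ d := by exact_mod_cast hd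
  have hdr : (0 : ℝ) < (d : ℝ) - 1 := by linarith
  have hb : 0 ≤ δ / ((d : ℝ) - 1) := by positivity
  have e : ∀ i, |mv δ y i - (if i = y then 1 else 0)| = mv δ y i + (if i = y then 2 * δ - 1 else 0) := by
    intro i; unfold mv; split_ifs
    · rw [abs_of_nonpos (by linarith)]; ring
    · rw [sub_zero, abs_of_nonneg hb]; ring
  simp only [e, Finset.sum_add_distrib, mv_sum hd]
  simp

/-- The local bound is at most the Audenaert–Fannes bound, with equality iff
`σ` is pure, or `ε < 1 − 1/d` and `σ` has eigenvalues `(1−ε, ε/(d−1), …, ε/(d−1))`, or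
`ε ≥ 1 − 1/d` and `σ` is the completely mixed state. -/
theorem local_bound_le_AF
    {d : ℕ} (hd : 2 ≤ d) (σ : MState d) (ε : ℝ) (hε : ε ∈ Set.Ioc (0 : ℝ) 1)
    (ρstar ρlow : MState d)
    (hρstar : inBall ε σ ρstar ∧ ∀ ω : MState d, inBall ε σ ω → Maj ρstar ω)
    (hρlow : inBall ε σ ρlow ∧ ∀ ω : MState d, inBall ε σ ω → Maj ω ρlow) :
    max (vnEnt ρstar - vnEnt σ) (vnEnt σ - vnEnt ρlow) ≤ AF d ε ∧
    (max (vnEnt ρstar - vnEnt σ) (vnEnt σ - vnEnt ρlow) = AF d ε ↔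
      (IsPure σ ∨
       (ε < 1 - 1 / d ∧ ∃ π : Equiv.Perm (Fin d), ∀ i : Fin d,
          eigs σ.1 (π i) = if (i : ℕ) = 0 then 1 - ε else ε / ((d : ℝ) - 1)) ∨
       (1 - 1 / d ≤ ε ∧ σ.1 = mixedMat d))) := by
  have hd2 : (2 : ℝ) ≤ d := by exact_mod_cast hd
  have hdr : (0 : ℝ) < (d : ℝ) - 1 := by linarith
  have hdi : 1 / (d : ℝ) ≤ 1 / 2 := one_div_le_one_div_of_le (by norm_num) hd2
  have hdi0 : 0 < 1 / (d : ℝ) := by positivity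
  have hl : 0 < Real.log 2 := Real.log_pos (by norm_num)
  obtain ⟨δ, hδ⟩ : ∃ δ, δ = min ε (1 - 1 / (d : ℝ)) := ⟨_, rfl⟩
  have hδ0 : 0 < δ := by rw [hδ]; exact lt_min hε.1 (by linarith)
  have hδle : δ ≤ 1 - 1 / (d : ℝ) := by rw [hδ]; exact min_le_right _ _
  have hδε : δ ≤ ε := by rw [hδ]; exact min_le_left _ _
  have hb0 : 0 ≤ δ / ((d : ℝ) - 1) := by positivity
  have hba : δ / ((d : ℝ) - 1) ≤ 1 - δ := by
    rw [div_le_iff₀ hdr]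
    have : 1 / (d : ℝ) * d = 1 := by field_simp
    nlinarith
  rw [cases_iff hd hδ, pure_iff, AF_eq hd hε.1 hδ]
  obtain ⟨s1, s2⟩ := quantumAF hd hε.1 hδ ρstar σ hρstar.1
  have hlow : (1 / 2 : ℝ) * traceNorm (σ.1 - ρlow.1) ≤ ε := by
    rw [traceNorm_sub_comm σ.2.1.isHermitian ρlow.2.1.isHermitian]; exact hρlow.1
  obtain ⟨l1, l2⟩ := quantumAF hd hε.1 hδ σ ρlow hlow
  refine ⟨max_le s1 l1, fun h => ?_, fun h => ?_⟩
  · rcases max_choice (vnEnt ρstar - vnEnt σ) (vnEnt σ - vnEnt ρlow) with hc | hc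
    · rw [hc] at h; exact Or.inl (s2 h).1
    · rw [hc] at h; exact Or.inr (l2 h).2
  · obtain ⟨W, h1, h2, hW⟩ := spec σ.2.1.isHermitian
    have hmv0 : ∀ y i : Fin d, 0 ≤ mv δ y i := by
      intro y i; unfold mv; split_ifs <;> linarith
    apply le_antisymm (max_le s1 l1)
    rcases h with ⟨y, hy⟩ | ⟨y, hy⟩
    · apply le_max_of_le_left
      let ω : MState d := mkState W h2 (mv δ y) (hmv0 y) (mv_sum hd δ y)
      have hω : ω.1 = cj W (mv δ y) := rfl
      have hball : inBall ε σ ω := by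
        unfold inBall
        rw [hω]
        conv_lhs => rw [hW]
        rw [cj_sub, traceNorm_cj h1 h2]
        simp only [hy]
        rw [mv_dist hd hδ0.le]; exact hδε
      have hmaj := hρstar.2 ω hball
      obtain ⟨π, hπ⟩ := eigs_cj h1 h2 (mv δ y)
      rw [← hω] at hπ
      have hval : ∀ i, eigs ω.1 i = mv δ y (π.symm i) := fun i => by rw [← hπ]; simp
      have hS : ∑ i, Real.negMulLog (eigs σ.1 i) = 0 := by
        apply Finset.sum_eq_zero; intro i _
        rw [hy]; split_ifs <;> simp
      have := ent_ge hd hδ0.le (eigs_sum ρstar)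
        (le_of_maj hd hmaj fun i => by rw [hval, mv]; split_ifs <;> linarith)
        (ge_of_maj hd hmaj fun i => by rw [hval, mv]; split_ifs <;> linarith)
      rw [vnEnt_eq, vnEnt_eq, hS, zero_div, sub_zero]
      exact (div_le_div_iff_of_pos_right hl).2 this
    · apply le_max_of_le_right
      let ω : MState d := mkState W h2 (fun i => if i = y then 1 else 0)
        (fun i => by split_ifs <;> norm_num) (by simp)
      have hω : ω.1 = cj W (fun i => if i = y then 1 else 0) := rfl
      have hball : inBall ε σ ω := by
        unfold inBall
        rw [hω]
        conv_lhs => rw [hW]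
        rw [cj_sub, traceNorm_cj h1 h2]
        simp only [hy, abs_sub_comm _ (mv δ y _)]
        rw [mv_dist hd hδ0.le]; exact hδε
      have hmaj := hρlow.2 ω hball
      obtain ⟨π, hπ⟩ := eigs_cj h1 h2 (fun i => if i = y then (1 : ℝ) else 0)
      rw [← hω] at hπ
      have hone : eigs ω.1 (π y) = 1 := by rw [hπ]; simp
      have hle1 : ∀ i, eigs ρlow.1 i ≤ 1 := fun i => by
        rw [← eigs_sum ρlow]
        exact Finset.single_le_sum (fun i _ => eigs_nonneg ρlow i) (Finset.mem_univ i)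
      obtain ⟨t, ht⟩ : ∃ t, eigs ρlow.1 t = 1 := by
        by_contra! hn
        have hlt : ∀ i, eigs ρlow.1 i < 1 := fun i => lt_of_le_of_ne (hle1 i) (hn i)
        have : Nonempty (Fin d) := ⟨y⟩
        obtain ⟨t, ht⟩ := Finite.exists_max (eigs ρlow.1)
        have := le_of_maj hd hmaj ht (π y)
        linarith [hlt t]
      have hS : ∑ i, Real.negMulLog (eigs ρlow.1 i) = 0 := by
        apply Finset.sum_eq_zero; intro i _
        have h4 := Finset.add_sum_erase Finset.univ (eigs ρlow.1) (Finset.mem_univ t)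
        rw [eigs_sum, ht] at h4
        have h5 : ∑ i ∈ Finset.univ.erase t, eigs ρlow.1 i = 0 := by linarith
        rcases eq_or_ne i t with rfl | hne
        · rw [ht]; simp
        · rw [(Finset.sum_eq_zero_iff_of_nonneg fun i _ => eigs_nonneg ρlow i).1 h5 i
            (Finset.mem_erase.2 ⟨hne, Finset.mem_univ i⟩)]
          simp
      rw [vnEnt_eq, vnEnt_eq, hS, zero_div, sub_zero]
      simp only [hy]
      rw [mv_ent hd]
end
end

section
/- Let d ≥ 2, ε ∈ (0,1], and let ρ, σ be states on ℂ^d with (1/2)‖ρ − σ‖₁ ≤ ε and S(ρ) ≥ S(σ). Then: (i) if ε < 1 − 1/d, S(ρ) − S(σ) = ε log₂(d−1) + h(ε) holds if and only if σ is a pure state and the eigenvalues of ρ, arranged in non-increasing order, are (1−ε, ε/(d−1), …, ε/(d−1)); (ii) if ε ≥ 1 − 1/d, S(ρ) − S(σ) = log₂ d holds if and only if σ is a pure state and ρ = (1/d)·I. In both cases the stated value is an upper bound for S(ρ) − S(σ). -/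
open scoped BigOperators ComplexOrder

noncomputable section

open Matrix in
lemma af_quad {d : ℕ} {A : Matrix (Fin d) (Fin d) ℂ} (hA : A.IsHermitian) (x : Fin d → ℂ) :
    (star x ⬝ᵥ A *ᵥ x).re = ∑ j, hA.eigenvalues j *
      Complex.normSq ((star (hA.eigenvectorUnitary : Matrix (Fin d) (Fin d) ℂ) *ᵥ x) j) := by
  conv_lhs => rw [hA.spectral_theorem]
  rw [Unitary.conjStarAlgAut_apply, ← Matrix.mulVec_mulVec, ← Matrix.mulVec_mulVec,
    Matrix.dotProduct_mulVec]
  have : star x ᵥ* (hA.eigenvectorUnitary : Matrix (Fin d) (Fin d) ℂ)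
      = star (star (hA.eigenvectorUnitary : Matrix (Fin d) (Fin d) ℂ) *ᵥ x) := by
    rw [Matrix.star_mulVec]; simp [Matrix.star_eq_conjTranspose]
  rw [this]
  simp only [dotProduct, Matrix.mulVec_diagonal, Complex.re_sum]
  refine Finset.sum_congr rfl fun j _ => ?_
  simp [Complex.normSq_apply]
  ring

open Matrix in
lemma af_norm {d : ℕ} (U : Matrix.unitaryGroup (Fin d) ℂ) (x : Fin d → ℂ) :
    ∑ j, Complex.normSq ((star (U : Matrix (Fin d) (Fin d) ℂ) *ᵥ x) j)
      = ∑ j, Complex.normSq (x j) := by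
  have key : ∀ y : Fin d → ℂ, (∑ j, Complex.normSq (y j)) = (star y ⬝ᵥ y).re := by
    intro y
    simp [dotProduct, Complex.re_sum, Complex.normSq_apply]
  rw [key, key, Matrix.star_mulVec, ← Matrix.dotProduct_mulVec, Matrix.mulVec_mulVec]
  simp [Matrix.star_eq_conjTranspose]
  rw [← Matrix.star_eq_conjTranspose, Unitary.mul_star_self_of_mem U.2]
  simp

open Matrix in
lemma af_weyl {d : ℕ} {A B : Matrix (Fin d) (Fin d) ℂ} (hA : A.IsHermitian)
    (hB : B.IsHermitian) (h : (B - A).PosSemidef) (i : Fin d) :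
    hA.eigenvalues i ≤ hB.eigenvalues i := by
  classical
  by_contra hlt
  push Not at hlt
  set a := hA.eigenvalues with ha
  set b := hB.eigenvalues with hb
  have hcomp : ∀ k, b i < b k → a i ≤ a k := by
    intro k hk
    simp only [ha, hb, Matrix.IsHermitian.eigenvalues] at hk ⊢
    apply hA.eigenvalues₀_antitone
    by_contra hc
    push Not at hc
    exact absurd (hB.eigenvalues₀_antitone hc.le) (not_le.mpr hk)
  let U : Matrix (Fin d) (Fin d) ℂ := star (hA.eigenvectorUnitary : Matrix (Fin d) (Fin d) ℂ)
  let V : Matrix (Fin d) (Fin d) ℂ := star (hB.eigenvectorUnitary : Matrix (Fin d) (Fin d) ℂ)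
  let M : Matrix (Fin d) (Fin d) ℂ := Matrix.of fun j =>
    if b i < b j then V j else if a j < a i then U j else 0
  have hM : M.det = 0 := by
    apply Matrix.det_eq_zero_of_row_eq_zero i
    intro j
    simp [M]
  obtain ⟨x, hx0, hx⟩ := Matrix.exists_mulVec_eq_zero_iff.mpr hM
  have h1 : ∀ j, b i < b j → (V *ᵥ x) j = 0 := by
    intro j hj
    have := congrFun hx j
    simpa [M, Matrix.mulVec, hj] using this
  have h2 : ∀ j, a j < a i → (U *ᵥ x) j = 0 := by
    intro j hj
    have := congrFun hx j
    have hn : ¬ b i < b j := fun hc => absurd (hcomp j hc) (not_le.mpr hj)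
    simpa [M, Matrix.mulVec, hj, hn] using this
  have hpos : 0 < ∑ j, Complex.normSq (x j) := by
    obtain ⟨j, hj⟩ := Function.ne_iff.mp hx0
    exact Finset.sum_pos' (fun _ _ => Complex.normSq_nonneg _)
      ⟨j, Finset.mem_univ _, Complex.normSq_pos.mpr hj⟩
  have qA : a i * ∑ j, Complex.normSq (x j) ≤ (star x ⬝ᵥ A *ᵥ x).re := by
    rw [af_quad hA, ← af_norm hA.eigenvectorUnitary x, Finset.mul_sum]
    refine Finset.sum_le_sum fun j _ => ?_
    by_cases hj : a j < a i
    · have := h2 j hj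
      simp only [U] at this
      simp [this]
    · exact mul_le_mul_of_nonneg_right (not_lt.mp hj) (Complex.normSq_nonneg _)
  have qB : (star x ⬝ᵥ B *ᵥ x).re ≤ b i * ∑ j, Complex.normSq (x j) := by
    rw [af_quad hB, ← af_norm hB.eigenvectorUnitary x, Finset.mul_sum]
    refine Finset.sum_le_sum fun j _ => ?_
    by_cases hj : b i < b j
    · have := h1 j hj
      simp only [V] at this
      simp [this]
    · exact mul_le_mul_of_nonneg_right (not_lt.mp hj) (Complex.normSq_nonneg _)
  have hp := (Complex.le_def.mp (h.dotProduct_mulVec_nonneg x)).1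
  rw [Matrix.sub_mulVec, dotProduct_sub] at hp
  simp at hp
  nlinarith

open Matrix in
lemma af_trace_eig {d : ℕ} {A : Matrix (Fin d) (Fin d) ℂ} (hA : A.IsHermitian) :
    A.trace.re = ∑ i, hA.eigenvalues i := by
  rw [hA.trace_eq_sum_eigenvalues]; simp

open Matrix in
lemma af_mirsky {d : ℕ} {A B : Matrix (Fin d) (Fin d) ℂ} (hA : A.IsHermitian)
    (hB : B.IsHermitian) (hC : (A - B).IsHermitian) (ht : A.trace = B.trace) :
    ∑ i, max (hA.eigenvalues i) (hB.eigenvalues i) ≤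
      ∑ i, hA.eigenvalues i + (1 / 2) * ∑ i, |hC.eigenvalues i| := by
  set l := hC.eigenvalues with hl
  set U : Matrix (Fin d) (Fin d) ℂ := (hC.eigenvectorUnitary : Matrix (Fin d) (Fin d) ℂ) with hU
  have hUU : Uᴴ * U = 1 := by
    rw [← Matrix.star_eq_conjTranspose]; exact Unitary.coe_star_mul_self _
  let D : (Fin d → ℝ) → Matrix (Fin d) (Fin d) ℂ := fun f =>
    U * Matrix.diagonal (fun i => (f i : ℂ)) * Uᴴ
  have hDpos : ∀ f : Fin d → ℝ, (∀ i, 0 ≤ f i) → (D f).PosSemidef := by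
    intro f hf
    refine Matrix.PosSemidef.mul_mul_conjTranspose_same ?_ U
    exact Matrix.PosSemidef.diagonal (fun i => by simpa using hf i)
  have hDtr : ∀ f, (D f).trace.re = ∑ i, f i := by
    intro f
    simp only [D]
    rw [Matrix.trace_mul_comm, ← Matrix.mul_assoc, hUU, Matrix.one_mul, Matrix.trace_diagonal]
    simp
  have hDl : D l = A - B := by
    conv_rhs => rw [hC.spectral_theorem]
    rw [Unitary.conjStarAlgAut_apply]
    rfl
  have hDadd : ∀ f g, D f + D g = D (f + g) := by
    intro f g
    simp only [D]
    rw [← Matrix.add_mul, ← Matrix.mul_add, Matrix.diagonal_add]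
    simp
  have hN : (D (fun i => max (-l i) 0)).PosSemidef := hDpos _ (fun i => le_max_right _ _)
  have hP : (D (fun i => max (l i) 0)).PosSemidef := hDpos _ (fun i => le_max_right _ _)
  have hE : (A + D (fun i => max (-l i) 0)).IsHermitian := hA.add hN.isHermitian
  have e1 := af_weyl hA hE (by simpa using hN)
  have e2 := af_weyl hB hE (by
    have : A + D (fun i => max (-l i) 0) - B = D (fun i => max (l i) 0) := by
      rw [add_sub_right_comm, ← hDl, hDadd]
      congr 1
      funext i
      simp only [Pi.add_apply]
      rcases le_total (l i) 0 with h | h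
      · rw [max_eq_left (by linarith), max_eq_right h]; ring
      · rw [max_eq_right (by linarith), max_eq_left h]; ring
    rw [this]; exact hP)
  have hl0 : ∑ i, l i = 0 := by
    rw [← af_trace_eig hC]; simp [ht]
  calc _ ≤ ∑ i, hE.eigenvalues i := Finset.sum_le_sum fun i _ => max_le (e1 i) (e2 i)
    _ = ∑ i, hA.eigenvalues i + ∑ i, max (-l i) 0 := by
        rw [← af_trace_eig hE, Matrix.trace_add, Complex.add_re, hDtr, af_trace_eig hA]
    _ = ∑ i, hA.eigenvalues i + ∑ i, ((1/2) * |l i| - (1/2) * l i) := by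
        congr 1
        refine Finset.sum_congr rfl fun i _ => ?_
        rcases le_total (l i) 0 with h | h
        · rw [max_eq_left (by linarith), abs_of_nonpos h]; ring
        · rw [max_eq_right (by linarith), abs_of_nonneg h]; ring
    _ = _ := by
        rw [Finset.sum_sub_distrib, ← Finset.mul_sum, ← Finset.mul_sum, hl0]; ring

lemma af_term {p s q r : ℝ} (hp : 0 ≤ p) (hs : p ≤ s) (hr : p ≤ r) (hq : 0 < q) :
    p * (Real.log s + Real.log q - Real.log r) ≤ s * q - p ∧
    (p * (Real.log s + Real.log q - Real.log r) = s * q - p → 0 < s → 0 < p ∧ r = s * q) := by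
  rcases hp.eq_or_lt with h | h
  · subst h
    refine ⟨by simp; positivity, fun he h0 => ?_⟩
    have : 0 < s * q := by positivity
    simp at he
    rcases he with he | he <;> linarith
  · have hs0 : 0 < s := by linarith
    have hr0 : 0 < r := by linarith
    have hlog : Real.log s + Real.log q - Real.log r = Real.log (s * q / r) := by
      rw [Real.log_div (by positivity) (by positivity), Real.log_mul (by positivity) (by positivity)]
    rw [hlog]
    have hpos : 0 < s * q / r := by positivity
    have hle : p * (s * q / r) ≤ s * q := by
      rw [mul_div_assoc', div_le_iff₀ hr0]
      nlinarith [mul_pos hs0 hq]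
    have h1 := Real.log_le_sub_one_of_pos hpos
    refine ⟨by nlinarith, fun he _ => ⟨h, ?_⟩⟩
    by_contra hne
    have hne1 : s * q / r ≠ 1 := by
      intro hc
      rw [div_eq_one_iff_eq hr0.ne'] at hc
      exact hne hc.symm
    have h2 := Real.log_lt_sub_one_of_pos hpos hne1
    nlinarith

lemma af_fano {d : ℕ} (p q : Fin d → Fin d → ℝ) (r s : Fin d → ℝ)
    (hp : ∀ x y, 0 ≤ p x y) (hpr : ∀ x, ∑ y, p x y = r x) (hps : ∀ y, ∑ x, p x y = s y)
    (hs1 : ∑ y, s y = 1) (hq : ∀ x y, 0 < q x y) (hq1 : ∀ y, ∑ x, q x y = 1) :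
    ∑ y, s y * Real.log (s y) - ∑ x, r x * Real.log (r x)
      ≤ - ∑ y, ∑ x, p x y * Real.log (q x y) ∧
    (∑ y, s y * Real.log (s y) - ∑ x, r x * Real.log (r x)
      = - ∑ y, ∑ x, p x y * Real.log (q x y) →
      ∀ x y, 0 < s y → 0 < p x y ∧ r x = s y * q x y) := by
  have hterm := fun y x => af_term (hp x y)
    (show p x y ≤ s y by rw [← hps y]; exact Finset.single_le_sum (f := fun x => p x y) (fun i _ => hp i y) (Finset.mem_univ x))
    (show p x y ≤ r x by rw [← hpr x]; exact Finset.single_le_sum (f := fun y => p x y) (fun i _ => hp x i) (Finset.mem_univ y))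
    (hq x y)
  have hL : ∑ y, ∑ x, p x y * (Real.log (s y) + Real.log (q x y) - Real.log (r x))
      = ∑ y, s y * Real.log (s y) - ∑ x, r x * Real.log (r x)
        + ∑ y, ∑ x, p x y * Real.log (q x y) := by
    have e1 : ∑ y, ∑ x, p x y * Real.log (s y) = ∑ y, s y * Real.log (s y) := by
      refine Finset.sum_congr rfl fun y _ => ?_
      rw [← Finset.sum_mul, hps]
    have e2 : ∑ y, ∑ x, p x y * Real.log (r x) = ∑ x, r x * Real.log (r x) := by
      rw [Finset.sum_comm]
      refine Finset.sum_congr rfl fun y _ => ?_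
      rw [← Finset.sum_mul, hpr]
    rw [← e1, ← e2]
    simp only [mul_sub, mul_add, Finset.sum_sub_distrib, Finset.sum_add_distrib]
    ring
  have hR : ∑ y, ∑ x, (s y * q x y - p x y) = 0 := by
    simp only [Finset.sum_sub_distrib, ← Finset.mul_sum, hq1, hps, mul_one, hs1]
    simp
  have hle : ∑ y, ∑ x, p x y * (Real.log (s y) + Real.log (q x y) - Real.log (r x))
      ≤ ∑ y, ∑ x, (s y * q x y - p x y) :=
    Finset.sum_le_sum fun y _ => Finset.sum_le_sum fun x _ => (hterm y x).1
  refine ⟨by linarith, fun he x y hy => ?_⟩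
  have heq : ∑ y, ∑ x, p x y * (Real.log (s y) + Real.log (q x y) - Real.log (r x))
      = ∑ y, ∑ x, (s y * q x y - p x y) := by linarith
  have h1 := (Finset.sum_eq_sum_iff_of_le
    (fun y _ => Finset.sum_le_sum fun x _ => (hterm y x).1)).mp heq y (Finset.mem_univ _)
  have h2 := (Finset.sum_eq_sum_iff_of_le (fun x _ => (hterm y x).1)).mp h1 x (Finset.mem_univ _)
  exact (hterm y x).2 h2 hy

lemma af_ite_sum {d : ℕ} (y : Fin d) (a b : ℝ) :
    ∑ x, (if x = y then a else b) = a + ((d : ℝ) - 1) * b := by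
  have : ∀ x : Fin d, (if x = y then a else b) = (if x = y then a - b else 0) + b := by
    intro x; split_ifs <;> ring
  simp only [this, Finset.sum_add_distrib, Finset.sum_ite_eq', Finset.mem_univ, if_true,
    Finset.sum_const, Finset.card_univ, Fintype.card_fin, nsmul_eq_mul]
  ring

lemma af_classical {d : ℕ} (hd : 2 ≤ d) (ε : ℝ) (h0 : 0 < ε) (h1 : ε < 1 - 1 / d)
    (r s : Fin d → ℝ) (hr : ∀ i, 0 ≤ r i) (hs : ∀ i, 0 ≤ s i) (hr1 : ∑ i, r i = 1)
    (hs1 : ∑ i, s i = 1) (hm : ∑ i, max (r i) (s i) ≤ 1 + ε) :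
    ∑ y, s y * Real.log (s y) - ∑ x, r x * Real.log (r x)
      ≤ -((1 - ε) * Real.log (1 - ε) + ε * Real.log (ε / ((d : ℝ) - 1))) ∧
    (∑ y, s y * Real.log (s y) - ∑ x, r x * Real.log (r x)
      = -((1 - ε) * Real.log (1 - ε) + ε * Real.log (ε / ((d : ℝ) - 1))) →
      ∃ y, (∀ x, s x = if x = y then 1 else 0) ∧
        ∀ x, r x = if x = y then 1 - ε else ε / ((d : ℝ) - 1)) := by
  classical
  have hd' : (2 : ℝ) ≤ d := by exact_mod_cast hd
  have hd1 : (0 : ℝ) < (d : ℝ) - 1 := by linarith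
  have hlt : ε / ((d : ℝ) - 1) < 1 - ε := by
    rw [div_lt_iff₀ hd1]
    have : ε * d < d - 1 := by
      have := mul_lt_mul_of_pos_right h1 (by linarith : (0 : ℝ) < d)
      rw [sub_mul, one_div, inv_mul_cancel₀ (by linarith)] at this
      linarith
    nlinarith
  have hb0 : 0 < ε / ((d : ℝ) - 1) := by positivity
  have hlog : Real.log (ε / ((d : ℝ) - 1)) < Real.log (1 - ε) := Real.log_lt_log hb0 hlt
  set P : Fin d → ℝ := fun x => max (r x) (s x) - s x with hP
  set N : Fin d → ℝ := fun x => max (r x) (s x) - r x with hN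
  have hP0 : ∀ x, 0 ≤ P x := fun x => sub_nonneg.mpr (le_max_right _ _)
  have hN0 : ∀ x, 0 ≤ N x := fun x => sub_nonneg.mpr (le_max_left _ _)
  set δ := ∑ x, max (r x) (s x) - 1 with hδ
  have hPs : ∑ x, P x = δ := by simp [hP, Finset.sum_sub_distrib, hs1, hδ]
  have hNs : ∑ x, N x = δ := by simp [hN, Finset.sum_sub_distrib, hr1, hδ]
  have hPN : ∀ x, P x * N x = 0 := by
    intro x
    simp only [hP, hN]
    rcases le_total (r x) (s x) with h | h
    · rw [max_eq_right h]; ring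
    · rw [max_eq_left h]; ring
  have hPd : ∀ x, P x * δ / δ = P x := by
    intro x
    by_cases h : δ = 0
    · rw [h] at hPs
      have := (Finset.sum_eq_zero_iff_of_nonneg (fun i _ => hP0 i)).mp hPs x (Finset.mem_univ _)
      rw [this]; simp
    · field_simp
  have hNd : ∀ x, δ * N x / δ = N x := by
    intro x
    by_cases h : δ = 0
    · rw [h] at hNs
      have := (Finset.sum_eq_zero_iff_of_nonneg (fun i _ => hN0 i)).mp hNs x (Finset.mem_univ _)
      rw [this]; simp
    · field_simp
  have hδ0 : 0 ≤ δ := by rw [← hPs]; exact Finset.sum_nonneg fun i _ => hP0 i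
  let p : Fin d → Fin d → ℝ := fun x y => (if x = y then min (r x) (s x) else 0) + P x * N y / δ
  let q : Fin d → Fin d → ℝ := fun x y => if x = y then 1 - ε else ε / ((d : ℝ) - 1)
  have hp : ∀ x y, 0 ≤ p x y := by
    intro x y
    have := div_nonneg (mul_nonneg (hP0 x) (hN0 y)) hδ0
    have h2 := le_min (hr x) (hs x)
    simp only [p]
    split_ifs <;> linarith
  have hmr : ∀ x, min (r x) (s x) + P x = r x := by
    intro x; have := min_add_max (r x) (s x); simp only [hP]; linarith
  have hms : ∀ x, min (r x) (s x) + N x = s x := by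
    intro x; have := min_add_max (r x) (s x); simp only [hN]; linarith
  have hpr : ∀ x, ∑ y, p x y = r x := by
    intro x
    simp only [p, Finset.sum_add_distrib, Finset.sum_ite_eq, Finset.mem_univ, if_true,
      ← Finset.sum_div, ← Finset.mul_sum, hNs, hPd, hmr]
  have hps : ∀ y, ∑ x, p x y = s y := by
    intro y
    simp only [p, Finset.sum_add_distrib, Finset.sum_ite_eq', Finset.mem_univ, if_true,
      ← Finset.sum_div, ← Finset.sum_mul, hPs, hNd, hms]
  have hq : ∀ x y, 0 < q x y := by
    intro x y
    simp only [q]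
    split_ifs <;> linarith
  have hq1 : ∀ y, ∑ x, q x y = 1 := by
    intro y
    simp only [q]
    rw [af_ite_sum]
    field_simp
    ring
  obtain ⟨f1, f2⟩ := af_fano p q r s hp hpr hps hs1 hq hq1
  have hdiag : ∑ y, p y y = 1 - δ := by
    have : ∀ y, p y y = s y - N y := by
      intro y
      simp only [p, if_true, hPN, zero_div]
      linarith [hms y]
    simp only [this, Finset.sum_sub_distrib, hs1, hNs]
  have hpq : ∑ y, ∑ x, p x y * Real.log (q x y)
      = (1 - δ) * Real.log (1 - ε) + δ * Real.log (ε / ((d : ℝ) - 1)) := by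
    have : ∀ y, ∑ x, p x y * Real.log (q x y)
        = p y y * (Real.log (1 - ε) - Real.log (ε / ((d : ℝ) - 1)))
          + s y * Real.log (ε / ((d : ℝ) - 1)) := by
      intro y
      have e : ∀ x, p x y * Real.log (q x y) =
          (if x = y then p x y * (Real.log (1 - ε) - Real.log (ε / ((d : ℝ) - 1))) else 0)
          + p x y * Real.log (ε / ((d : ℝ) - 1)) := by
        intro x
        simp only [q]
        split_ifs <;> ring
      simp only [e, Finset.sum_add_distrib, Finset.sum_ite_eq', Finset.mem_univ, if_true,
        ← Finset.sum_mul, hps]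
    simp only [this, Finset.sum_add_distrib, ← Finset.sum_mul, hs1, hdiag]
    ring
  rw [hpq] at f1 f2
  have hδε : δ ≤ ε := by linarith
  have hbd : -((1 - δ) * Real.log (1 - ε) + δ * Real.log (ε / ((d : ℝ) - 1)))
      ≤ -((1 - ε) * Real.log (1 - ε) + ε * Real.log (ε / ((d : ℝ) - 1))) := by
    nlinarith
  refine ⟨f1.trans hbd, fun he => ?_⟩
  have hall := f2 (le_antisymm f1 (by rw [he]; exact hbd))
  obtain ⟨y, -, hy⟩ : ∃ y ∈ Finset.univ, 0 < s y := by
    by_contra hc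
    push Not at hc
    have := Finset.sum_nonpos hc
    linarith
  have hoff : ∀ x, x ≠ y → s x = 0 := by
    intro x hx
    by_contra hc
    have hsx : 0 < s x := lt_of_le_of_ne (hs x) (Ne.symm hc)
    have a1 := (hall x y hy).1
    have a2 := (hall y x hsx).1
    simp only [p, hx, hx.symm, if_false, zero_add] at a1 a2
    have b1 : P x ≠ 0 := by intro h; simp [h] at a1
    have b2 : N x ≠ 0 := by intro h; simp [h] at a2
    exact mul_ne_zero b1 b2 (hPN x)
  have hsy : s y = 1 := by
    rw [← hs1]
    exact (Finset.sum_eq_single y (fun b _ hb => hoff b hb) (by simp)).symm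
  refine ⟨y, fun x => ?_, fun x => ?_⟩
  · split_ifs with h
    · rw [h, hsy]
    · exact hoff x h
  · have := (hall x y hy).2
    rw [this, hsy, one_mul]

/-- Natural-log entropy bound. -/
lemma af_max {d : ℕ} (hd : 2 ≤ d) (r : Fin d → ℝ) (hr : ∀ i, 0 ≤ r i) (hr1 : ∑ i, r i = 1) :
    -∑ x, r x * Real.log (r x) ≤ Real.log d ∧
    (-∑ x, r x * Real.log (r x) = Real.log d → ∀ x, r x = 1 / d) := by
  have hd0 : (0 : ℝ) < d := by positivity
  have ht := fun x => af_term (q := 1 / d) (hr x)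
    (show r x ≤ 1 by rw [← hr1]; exact Finset.single_le_sum (fun i _ => hr i) (Finset.mem_univ x))
    (le_refl _) (by positivity)
  have hL : ∑ x, r x * (Real.log 1 + Real.log (1 / d) - Real.log (r x))
      = -∑ x, r x * Real.log (r x) - Real.log d := by
    simp only [mul_sub, Finset.sum_sub_distrib, ← Finset.sum_mul, hr1]
    simp; ring
  have hR : ∑ x, (1 * (1 / (d : ℝ)) - r x) = 0 := by
    rw [Finset.sum_sub_distrib, hr1]
    simp
    field_simp; simp
  have hle := Finset.sum_le_sum (s := Finset.univ) fun x _ => (ht x).1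
  refine ⟨by linarith, fun he x => ?_⟩
  have := (Finset.sum_eq_sum_iff_of_le (fun x _ => (ht x).1)).mp (by linarith) x (Finset.mem_univ _)
  have := (ht x).2 this one_pos
  linarith [this.2]

lemma af_zero {d : ℕ} (r : Fin d → ℝ) (hr : ∀ i, 0 ≤ r i) (hr1 : ∑ i, r i = 1) :
    ∑ x, r x * Real.log (r x) ≤ 0 ∧
    (∑ x, r x * Real.log (r x) = 0 → ∀ x, r x * r x = r x) := by
  have hle1 : ∀ x, r x ≤ 1 := fun x => by
    rw [← hr1]; exact Finset.single_le_sum (fun i _ => hr i) (Finset.mem_univ x)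
  have h : ∀ x, r x * Real.log (r x) ≤ 0 := fun x =>
    mul_nonpos_of_nonneg_of_nonpos (hr x) (Real.log_nonpos (hr x) (hle1 x))
  refine ⟨Finset.sum_nonpos fun x _ => h x, fun he x => ?_⟩
  have := (Finset.sum_eq_zero_iff_of_nonpos (fun x _ => h x)).mp he x (Finset.mem_univ _)
  rcases mul_eq_zero.mp this with h | h
  · simp [h]
  · rcases Real.log_eq_zero.mp h with h | h | h
    · simp [h]
    · simp [h]
    · have := hr x; linarith

lemma af_zero' {d : ℕ} (r : Fin d → ℝ) (h : ∀ x, r x * r x = r x) :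
    ∑ x, r x * Real.log (r x) = 0 := by
  refine Finset.sum_eq_zero fun x _ => ?_
  have : r x * (r x - 1) = 0 := by linarith [h x]
  rcases mul_eq_zero.mp this with h | h
  · simp [h]
  · rw [show r x = 1 by linarith]; simp

open Matrix in
lemma af_pure {d : ℕ} {A : Matrix (Fin d) (Fin d) ℂ} (hA : A.IsHermitian) :
    A * A = A ↔ ∀ x, hA.eigenvalues x * hA.eigenvalues x = hA.eigenvalues x := by
  have h := hA.spectral_theorem
  set φ := Unitary.conjStarAlgAut ℂ (Matrix (Fin d) (Fin d) ℂ) hA.eigenvectorUnitary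
  set l := hA.eigenvalues
  have : A * A = A ↔ diagonal (RCLike.ofReal ∘ l : Fin d → ℂ) * diagonal (RCLike.ofReal ∘ l)
      = diagonal (RCLike.ofReal ∘ l) := by
    rw [h, ← map_mul]
    exact φ.injective.eq_iff
  rw [this, Matrix.diagonal_mul_diagonal, Matrix.diagonal_injective.eq_iff, funext_iff]
  refine forall_congr' fun x => ?_
  simp only [Function.comp_apply]
  norm_cast

open Matrix in
lemma af_mixed {d : ℕ} {A : Matrix (Fin d) (Fin d) ℂ} (hA : A.IsHermitian) :
    A = mixedMat d ↔ ∀ x, hA.eigenvalues x = 1 / d := by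
  have h := hA.spectral_theorem
  set φ := Unitary.conjStarAlgAut ℂ (Matrix (Fin d) (Fin d) ℂ) hA.eigenvectorUnitary
  set l := hA.eigenvalues
  have hm : mixedMat d = φ (diagonal (RCLike.ofReal ∘ (fun _ => 1 / (d : ℝ)) : Fin d → ℂ)) := by
    have : diagonal (RCLike.ofReal ∘ (fun _ => 1 / (d : ℝ)) : Fin d → ℂ) = ((d : ℂ)⁻¹) • 1 := by
      ext i j
      by_cases hij : i = j <;> simp [hij]
    rw [this, map_smul, map_one]; rfl
  rw [hm, h, (EquivLike.injective φ).eq_iff, Matrix.diagonal_injective.eq_iff, funext_iff]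
  refine forall_congr' fun x => ?_
  simp only [Function.comp_apply]
  norm_cast

/-- Equality conditions in the Audenaert–Fannes inequality. -/
theorem audenaert_fannes_equality_conditions
    {d : ℕ} (hd : 2 ≤ d) (ε : ℝ) (hε : ε ∈ Set.Ioc (0 : ℝ) 1) (ρ σ : MState d)
    (hdist : (1 / 2 : ℝ) * traceNorm (ρ.1 - σ.1) ≤ ε) (hS : vnEnt σ ≤ vnEnt ρ) :
    (ε < 1 - 1 / d →
      (vnEnt ρ - vnEnt σ ≤ ε * Real.logb 2 ((d : ℝ) - 1) + binEnt ε ∧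
        (vnEnt ρ - vnEnt σ = ε * Real.logb 2 ((d : ℝ) - 1) + binEnt ε ↔
          IsPure σ ∧ ∃ π : Equiv.Perm (Fin d), ∀ i : Fin d,
            eigs ρ.1 (π i) = if (i : ℕ) = 0 then 1 - ε else ε / ((d : ℝ) - 1)))) ∧
    (1 - 1 / d ≤ ε →
      (vnEnt ρ - vnEnt σ ≤ Real.logb 2 d ∧
        (vnEnt ρ - vnEnt σ = Real.logb 2 d ↔ IsPure σ ∧ ρ.1 = mixedMat d))) := by
  have hρ := ρ.2.1.isHermitian
  have hσ := σ.2.1.isHermitian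
  have hC : (ρ.1 - σ.1).IsHermitian := hρ.sub hσ
  have er : eigs ρ.1 = hρ.eigenvalues := by simp [eigs, hρ]
  have es : eigs σ.1 = hσ.eigenvalues := by simp [eigs, hσ]
  have ec : eigs (ρ.1 - σ.1) = hC.eigenvalues := by simp [eigs, hC]
  have hr0 : ∀ i, 0 ≤ hρ.eigenvalues i := ρ.2.1.eigenvalues_nonneg
  have hs0 : ∀ i, 0 ≤ hσ.eigenvalues i := σ.2.1.eigenvalues_nonneg
  have hr1 : ∑ i, hρ.eigenvalues i = 1 := by rw [← af_trace_eig, ρ.2.2]; simp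
  have hs1 : ∑ i, hσ.eigenvalues i = 1 := by rw [← af_trace_eig, σ.2.2]; simp
  have hmir := af_mirsky hρ hσ hC (by rw [ρ.2.2, σ.2.2])
  have hpure := af_pure hσ
  have hmixed := af_mixed hρ
  have hl2 : 0 < Real.log 2 := Real.log_pos (by norm_num)
  have vr : vnEnt ρ = (-∑ i, hρ.eigenvalues i * Real.log (hρ.eigenvalues i)) / Real.log 2 := by
    simp only [vnEnt, er, Real.logb, neg_div, Finset.sum_div, mul_div_assoc]
  have vs : vnEnt σ = (-∑ i, hσ.eigenvalues i * Real.log (hσ.eigenvalues i)) / Real.log 2 := by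
    simp only [vnEnt, es, Real.logb, neg_div, Finset.sum_div, mul_div_assoc]
  have hdiff : vnEnt ρ - vnEnt σ = (∑ i, hσ.eigenvalues i * Real.log (hσ.eigenvalues i)
      - ∑ i, hρ.eigenvalues i * Real.log (hρ.eigenvalues i)) / Real.log 2 := by
    rw [vr, vs]; ring
  rw [hr1] at hmir
  simp only [traceNorm, ec] at hdist
  rw [hdiff, IsPure, hpure, hmixed, er]
  generalize hρ.eigenvalues = r at *
  generalize hσ.eigenvalues = s at *
  have hd' : (2 : ℝ) ≤ d := by exact_mod_cast hd
  have hd1 : (0 : ℝ) < (d : ℝ) - 1 := by linarith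
  constructor
  · intro h1
    obtain ⟨c1, c2⟩ := af_classical hd ε hε.1 h1 r s hr0 hs0 hr1 hs1 (by linarith)
    have hval : ε * Real.logb 2 ((d : ℝ) - 1) + binEnt ε =
        (-((1 - ε) * Real.log (1 - ε) + ε * Real.log (ε / ((d : ℝ) - 1)))) / Real.log 2 := by
      rw [Real.log_div hε.1.ne' hd1.ne']
      simp only [binEnt, Real.logb]
      ring
    rw [hval, div_le_div_iff_of_pos_right hl2, div_left_inj' hl2.ne']
    refine ⟨c1, fun he => ?_, fun ⟨hp, π, hπ⟩ => ?_⟩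
    · obtain ⟨y, hy1, hy2⟩ := c2 he
      refine ⟨fun x => by rw [hy1]; split_ifs <;> simp, Equiv.swap ⟨0, by omega⟩ y, fun i => ?_⟩
      rw [hy2]
      have : (Equiv.swap ⟨0, by omega⟩ y i = y) ↔ (i : ℕ) = 0 := by
        rw [Equiv.swap_apply_eq_iff, Equiv.swap_apply_right, Fin.ext_iff]
      simp only [this]
    · rw [af_zero' s hp, ← Equiv.sum_comp π]
      have : ∀ i, r (π i) * Real.log (r (π i)) = if i = (⟨0, by omega⟩ : Fin d)
          then (1 - ε) * Real.log (1 - ε)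
          else ε / ((d : ℝ) - 1) * Real.log (ε / ((d : ℝ) - 1)) := by
        intro i
        rw [hπ]
        simp only [Fin.ext_iff]
        split_ifs <;> rfl
      simp only [this]
      rw [af_ite_sum, ← mul_assoc, mul_div_cancel₀ _ hd1.ne']
      ring
  · intro _
    obtain ⟨m1, m2⟩ := af_max hd r hr0 hr1
    obtain ⟨z1, z2⟩ := af_zero s hs0 hs1
    rw [Real.logb, div_le_div_iff_of_pos_right hl2, div_left_inj' hl2.ne']
    refine ⟨by linarith, fun he => ⟨z2 (by linarith), m2 (by linarith)⟩, fun ⟨hp, hm⟩ => ?_⟩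
    rw [af_zero' s hp]
    simp only [hm, Finset.sum_const, Finset.card_univ, Fintype.card_fin, nsmul_eq_mul]
    rw [one_div, Real.log_inv]
    field_simp
    ring
end
end

section
/- Let d ≥ 1, σ a state on ℂ^d, ε ∈ (0,1], and let f be a concave continuous real-valued function on the set of states on ℂ^d. Let ρ be a faithful (positive definite) state with (1/2)‖ρ − σ‖₁ ≤ ε, and suppose L is a Hermitian matrix such that for every traceless Hermitian matrix h, the one-sided directional derivative lim_{t→0⁺} (f(ρ + t h) − f(ρ))/t exists and equals tr(L h). Then tr(L (ρ − σ)) ≤ ε (λ₊(L) − λ₋(L)), and the following are equivalent: (1) tr(L (ρ − σ)) = ε (λ₊(L) − λ₋(L)); (2) f(ρ) = max{ f(ω) : ω ∈ B_ε(σ) }; (3) both (a) either (1/2)‖ρ − σ‖₁ = ε or L is a real multiple of the identity, and (b) π₊ L π₊ = λ₊(L) π₊ and π₋ L π₋ = λ₋(L) π₋, where Δ = (ρ − σ) = Δ₊ − Δ₋ is the Jordan decomposition and π₊, π₋ are the orthogonal projections onto the supports of Δ₊ and Δ₋. -/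
open scoped BigOperators ComplexOrder

noncomputable section

/-- The largest eigenvalue `λ₊` of a Hermitian matrix. -/
noncomputable def lamMax {d : ℕ} (A : Matrix (Fin d) (Fin d) ℂ) : ℝ :=
  ⨆ i, eigs A i

/-- The smallest eigenvalue `λ₋` of a Hermitian matrix. -/
noncomputable def lamMin {d : ℕ} (A : Matrix (Fin d) (Fin d) ℂ) : ℝ :=
  ⨅ i, eigs A i

/-- `P` is the orthogonal projection onto the support (range) of the Hermitian matrix `A`:
`P` is a Hermitian idempotent which acts as the identity on the range of `A` and vanishes on
its kernel. -/
def IsSupportProj {d : ℕ} (P A : Matrix (Fin d) (Fin d) ℂ) : Prop :=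
  P.IsHermitian ∧ P * P = P ∧ P * A = A ∧
    ∀ x : Fin d → ℂ, A.mulVec x = 0 → P.mulVec x = 0

/-- A quantum state: positive semidefinite with trace 1. -/
def IsState {d : ℕ} (A : Matrix (Fin d) (Fin d) ℂ) : Prop :=
  A.PosSemidef ∧ A.trace = 1

namespace GatAux
open Matrix

variable {d : ℕ}

lemma spec (A : Matrix (Fin d) (Fin d) ℂ) (hA : A.IsHermitian) :
    ∃ U : Matrix (Fin d) (Fin d) ℂ, Uᴴ * U = 1 ∧ U * Uᴴ = 1 ∧
      A = U * diagonal (fun i => (eigs A i : ℂ)) * Uᴴ := by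
  refine ⟨hA.eigenvectorUnitary, ?_, ?_, ?_⟩
  · exact Unitary.coe_star_mul_self hA.eigenvectorUnitary
  · exact Unitary.coe_mul_star_self hA.eigenvectorUnitary
  · have h := hA.spectral_theorem
    rw [Unitary.conjStarAlgAut_apply] at h
    have he : eigs A = hA.eigenvalues := by simp [eigs, hA]
    rw [he]
    exact h

lemma psd_conj (U : Matrix (Fin d) (Fin d) ℂ) (c : Fin d → ℝ) (hc : ∀ i, 0 ≤ c i) :
    (U * diagonal (fun i => (c i : ℂ)) * Uᴴ).PosSemidef := by
  apply PosSemidef.mul_mul_conjTranspose_same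
  apply PosSemidef.diagonal
  intro i
  simpa using hc i

lemma tr_conj (U : Matrix (Fin d) (Fin d) ℂ) (hU : Uᴴ * U = 1) (D : Matrix (Fin d) (Fin d) ℂ) :
    (U * D * Uᴴ).trace = D.trace := by
  rw [trace_mul_comm, ← mul_assoc, hU, one_mul]

lemma psd_fac {A : Matrix (Fin d) (Fin d) ℂ} (hA : A.PosSemidef) :
    ∃ M : Matrix (Fin d) (Fin d) ℂ, A = Mᴴ * M := by
  obtain ⟨U, h1, h2, h3⟩ := spec A hA.1
  have hn : ∀ i, 0 ≤ eigs A i := by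
    intro i
    have : eigs A = hA.1.eigenvalues := by simp [eigs, hA.1]
    rw [this]; exact hA.eigenvalues_nonneg i
  refine ⟨diagonal (fun i => (Real.sqrt (eigs A i) : ℂ)) * Uᴴ, ?_⟩
  rw [conjTranspose_mul, conjTranspose_conjTranspose, diagonal_conjTranspose, mul_assoc,
    ← mul_assoc (diagonal _) (diagonal _), diagonal_mul_diagonal]
  conv_lhs => rw [h3]
  rw [mul_assoc]
  congr 3
  ext i
  simp only [Pi.star_apply, RCLike.star_def, Complex.conj_ofReal]
  rw [← Complex.ofReal_mul, Real.mul_self_sqrt (hn i)]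

lemma tr_mul_fac (M N : Matrix (Fin d) (Fin d) ℂ) :
    ((Mᴴ * M) * (Nᴴ * N)).trace = ((M * Nᴴ) * (M * Nᴴ)ᴴ).trace := by
  rw [conjTranspose_mul, conjTranspose_conjTranspose, mul_assoc, trace_mul_comm]
  congr 1
  simp only [mul_assoc]

lemma tr_mul_nonneg {A B : Matrix (Fin d) (Fin d) ℂ} (hA : A.PosSemidef) (hB : B.PosSemidef) :
    0 ≤ (A * B).trace := by
  obtain ⟨M, rfl⟩ := psd_fac hA
  obtain ⟨N, rfl⟩ := psd_fac hB
  rw [tr_mul_fac]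
  exact (posSemidef_self_mul_conjTranspose _).trace_nonneg

lemma tr_mul_nonneg_re {A B : Matrix (Fin d) (Fin d) ℂ} (hA : A.PosSemidef)
    (hB : B.PosSemidef) : 0 ≤ (A * B).trace.re :=
  (Complex.le_def.1 (tr_mul_nonneg hA hB)).1

lemma mul_eq_zero_of_tr {A B : Matrix (Fin d) (Fin d) ℂ} (hA : A.PosSemidef)
    (hB : B.PosSemidef) (h : (A * B).trace.re = 0) : A * B = 0 := by
  have h0 : (A * B).trace = 0 :=
    Complex.ext h (Complex.le_def.1 (tr_mul_nonneg hA hB)).2.symm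
  obtain ⟨M, rfl⟩ := psd_fac hA
  obtain ⟨N, rfl⟩ := psd_fac hB
  rw [tr_mul_fac, trace_mul_conjTranspose_self_eq_zero_iff] at h0
  calc Mᴴ * M * (Nᴴ * N) = Mᴴ * (M * Nᴴ) * N := by simp only [mul_assoc]
    _ = 0 := by rw [h0]; simp

lemma le_lamMax (A : Matrix (Fin d) (Fin d) ℂ) (i : Fin d) : eigs A i ≤ lamMax A :=
  le_ciSup (Set.finite_range _).bddAbove i

lemma lamMin_le (A : Matrix (Fin d) (Fin d) ℂ) (i : Fin d) : lamMin A ≤ eigs A i :=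
  ciInf_le (Set.finite_range _).bddBelow i

lemma max_psd {L : Matrix (Fin d) (Fin d) ℂ} (hL : L.IsHermitian) :
    ((lamMax L : ℂ) • (1 : Matrix (Fin d) (Fin d) ℂ) - L).PosSemidef := by
  obtain ⟨U, h1, h2, h3⟩ := spec L hL
  have : (lamMax L : ℂ) • (1 : Matrix (Fin d) (Fin d) ℂ) - L =
      U * diagonal (fun i => ((lamMax L - eigs L i : ℝ) : ℂ)) * Uᴴ := by
    have : diagonal (fun i => ((lamMax L - eigs L i : ℝ) : ℂ)) =
      (lamMax L : ℂ) • (1 : Matrix (Fin d) (Fin d) ℂ) - diagonal (fun i => (eigs L i : ℂ)) := by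
      rw [smul_one_eq_diagonal, diagonal_sub]; congr 1; ext i; simp
    rw [this, mul_sub, sub_mul, ← h3]
    simp [h2]
  rw [this]
  exact psd_conj _ _ fun i => sub_nonneg.2 (le_lamMax L i)

lemma min_psd {L : Matrix (Fin d) (Fin d) ℂ} (hL : L.IsHermitian) :
    (L - (lamMin L : ℂ) • (1 : Matrix (Fin d) (Fin d) ℂ)).PosSemidef := by
  obtain ⟨U, h1, h2, h3⟩ := spec L hL
  have : L - (lamMin L : ℂ) • (1 : Matrix (Fin d) (Fin d) ℂ) =
      U * diagonal (fun i => ((eigs L i - lamMin L : ℝ) : ℂ)) * Uᴴ := by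
    have : diagonal (fun i => ((eigs L i - lamMin L : ℝ) : ℂ)) =
      diagonal (fun i => (eigs L i : ℂ)) - (lamMin L : ℂ) • (1 : Matrix (Fin d) (Fin d) ℂ) := by
      rw [smul_one_eq_diagonal, diagonal_sub]; congr 1; ext i; simp
    rw [this, mul_sub, sub_mul, ← h3]
    simp [h2]
  rw [this]
  exact psd_conj _ _ fun i => sub_nonneg.2 (lamMin_le L i)

lemma exists_eig {L : Matrix (Fin d) (Fin d) ℂ} (hL : L.IsHermitian) (i : Fin d) :
    ∃ Q : Matrix (Fin d) (Fin d) ℂ, Q.PosSemidef ∧ Q.trace = 1 ∧ (1 - Q).PosSemidef ∧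
      (L * Q).trace.re = eigs L i := by
  obtain ⟨U, h1, h2, h3⟩ := spec L hL
  refine ⟨U * diagonal (fun j => ((if j = i then 1 else 0 : ℝ) : ℂ)) * Uᴴ, ?_, ?_, ?_, ?_⟩
  · apply psd_conj
    intro j; split_ifs <;> simp
  · rw [tr_conj _ h1, trace_diagonal, ← Complex.ofReal_sum, Finset.sum_ite_eq']; simp
  · have : (1 : Matrix (Fin d) (Fin d) ℂ) -
        U * diagonal (fun j => ((if j = i then 1 else 0 : ℝ) : ℂ)) * Uᴴ =
        U * diagonal (fun j => ((1 - (if j = i then 1 else 0) : ℝ) : ℂ)) * Uᴴ := by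
      have : diagonal (fun j => ((1 - (if j = i then 1 else 0) : ℝ) : ℂ)) =
        1 - diagonal (fun j => ((if j = i then 1 else 0 : ℝ) : ℂ)) := by
        rw [← diagonal_one, diagonal_sub]; congr 1; ext j; simp
      rw [this, mul_sub, sub_mul, mul_one, h2]
    rw [this]
    apply psd_conj
    intro j; split_ifs <;> norm_num
  · have : L * (U * diagonal (fun j => ((if j = i then 1 else 0 : ℝ) : ℂ)) * Uᴴ) =
        U * (diagonal (fun i => (eigs L i : ℂ)) *
          diagonal (fun j => ((if j = i then 1 else 0 : ℝ) : ℂ))) * Uᴴ := by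
      conv_lhs => rw [h3]
      calc _ = U * diagonal (fun i => (eigs L i : ℂ)) * (Uᴴ * U) *
            diagonal (fun j => ((if j = i then 1 else 0 : ℝ) : ℂ)) * Uᴴ := by
              simp only [mul_assoc]
        _ = _ := by rw [h1]; simp only [mul_assoc, Matrix.mul_one]
    rw [this, tr_conj _ h1, diagonal_mul_diagonal, trace_diagonal]
    simp

/-- Jordan decomposition. -/
lemma exists_jordan {X : Matrix (Fin d) (Fin d) ℂ} (hX : X.IsHermitian) :
    ∃ A B : Matrix (Fin d) (Fin d) ℂ, A.PosSemidef ∧ B.PosSemidef ∧ X = A - B ∧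
      A.trace.re + B.trace.re = traceNorm X := by
  obtain ⟨U, h1, h2, h3⟩ := spec X hX
  refine ⟨U * diagonal (fun j => ((max (eigs X j) 0 : ℝ) : ℂ)) * Uᴴ,
    U * diagonal (fun j => ((max (-eigs X j) 0 : ℝ) : ℂ)) * Uᴴ,
    psd_conj _ _ fun i => le_max_right _ _, psd_conj _ _ fun i => le_max_right _ _, ?_, ?_⟩
  · rw [← sub_mul, ← mul_sub, diagonal_sub]
    conv_lhs => rw [h3]
    congr 3
    ext i
    rw [← Complex.ofReal_sub, max_zero_sub_max_neg_zero_eq_self]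
  · rw [tr_conj _ h1, tr_conj _ h1, trace_diagonal, trace_diagonal, traceNorm, Complex.re_sum,
      Complex.re_sum, ← Finset.sum_add_distrib]
    refine Finset.sum_congr rfl fun i _ => ?_
    simp only [Complex.ofReal_re]
    rcases le_total 0 (eigs X i) with h | h
    · rw [abs_of_nonneg h, max_eq_left h, max_eq_right (by linarith)]; ring
    · rw [abs_of_nonpos h, max_eq_right h, max_eq_left (by linarith)]; ring

lemma traceNorm_le {A B : Matrix (Fin d) (Fin d) ℂ} (hA : A.PosSemidef) (hB : B.PosSemidef) :
    traceNorm (A - B) ≤ A.trace.re + B.trace.re := by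
  have hX : (A - B).IsHermitian := hA.1.sub hB.1
  obtain ⟨U, h1, h2, h3⟩ := spec _ hX
  have hd : diagonal (fun i => (eigs (A - B) i : ℂ)) = Uᴴ * A * U - Uᴴ * B * U := by
    rw [← sub_mul, ← mul_sub]
    conv_rhs => rw [h3]
    calc _ = (Uᴴ * U) * diagonal (fun i => (eigs (A - B) i : ℂ)) * (Uᴴ * U) := by
          rw [h1]; simp
      _ = _ := by simp only [mul_assoc]
  have hA' := hA.conjTranspose_mul_mul_same U
  have hB' := hB.conjTranspose_mul_mul_same U
  have tA : A.trace = (Uᴴ * A * U).trace := by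
    rw [trace_mul_comm, ← mul_assoc, h2, one_mul]
  have tB : B.trace = (Uᴴ * B * U).trace := by
    rw [trace_mul_comm, ← mul_assoc, h2, one_mul]
  rw [tA, tB, trace, trace, Complex.re_sum, Complex.re_sum, ← Finset.sum_add_distrib, traceNorm]
  refine Finset.sum_le_sum fun i _ => ?_
  have e : (eigs (A - B) i : ℂ) = (Uᴴ * A * U) i i - (Uᴴ * B * U) i i := by
    have := congrFun (congrFun hd i) i
    rwa [diagonal_apply_eq] at this
  have e' := congrArg Complex.re e
  simp only [Complex.ofReal_re, Complex.sub_re] at e'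
  have a := (Complex.le_def.1 (hA'.diag_nonneg (i := i))).1
  have b := (Complex.le_def.1 (hB'.diag_nonneg (i := i))).1
  simp only [Complex.zero_re] at a b
  simp only [diag_apply]
  rw [e', abs_le]
  constructor <;> linarith

lemma supp_mul_zero {P A X : Matrix (Fin d) (Fin d) ℂ} (hP : IsSupportProj P A)
    (h : A * X = 0) : P * X = 0 := by
  ext i j
  have h1 : A.mulVec (fun k => X k j) = 0 := by
    ext l
    exact congrFun (congrFun h l) j
  exact congrFun (hP.2.2.2 _ h1) i

lemma proj_psd {P : Matrix (Fin d) (Fin d) ℂ} (h1 : P.IsHermitian) (h2 : P * P = P) :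
    P.PosSemidef := by
  have := posSemidef_conjTranspose_mul_self P
  rwa [h1.eq, h2] at this

lemma proj_psd' {P : Matrix (Fin d) (Fin d) ℂ} (h1 : P.IsHermitian) (h2 : P * P = P) :
    (1 - P).PosSemidef := by
  apply proj_psd (isHermitian_one.sub h1)
  simp [sub_mul, mul_sub, h2]

/-- half of the lower bound -/
lemma tr_le_of_proj {P A B D : Matrix (Fin d) (Fin d) ℂ} (h1 : P.IsHermitian) (h2 : P * P = P)
    (hA : A.PosSemidef) (hB : B.PosSemidef) (h : P * (A - B) = D) :
    D.trace.re ≤ A.trace.re := by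
  have a := tr_mul_nonneg_re (proj_psd' h1 h2) hA
  have b := tr_mul_nonneg_re (proj_psd h1 h2) hB
  rw [← h, mul_sub, trace_sub]
  rw [sub_mul, one_mul, trace_sub] at a
  simp only [Complex.sub_re] at *
  linarith

lemma jordan_traceNorm {Δp Δn Pp Pn : Matrix (Fin d) (Fin d) ℂ}
    (hΔp : Δp.PosSemidef) (hΔn : Δn.PosSemidef) (hOrth : Δp * Δn = 0)
    (hPp : IsSupportProj Pp Δp) (hPn : IsSupportProj Pn Δn) :
    traceNorm (Δp - Δn) = Δp.trace.re + Δn.trace.re := by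
  apply le_antisymm (traceNorm_le hΔp hΔn)
  obtain ⟨A, B, hA, hB, hX, ht⟩ := exists_jordan (hΔp.1.sub hΔn.1)
  have hOrth' : Δn * Δp = 0 := by
    have := congrArg conjTranspose hOrth
    rwa [conjTranspose_mul, hΔp.1.eq, hΔn.1.eq, conjTranspose_zero] at this
  have a := tr_le_of_proj (D := Δp) hPp.1 hPp.2.1 hA hB
    (by rw [← hX, mul_sub, hPp.2.2.1, supp_mul_zero hPp hOrth, sub_zero])
  have b := tr_le_of_proj (D := Δn) hPn.1 hPn.2.1 hB hA
    (by rw [← neg_sub A B, ← hX, neg_sub, mul_sub, hPn.2.2.1, supp_mul_zero hPn hOrth', sub_zero])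
  linarith

lemma tr_max_sub (L D : Matrix (Fin d) (Fin d) ℂ) (c : ℝ) :
    (((c : ℂ) • (1 : Matrix (Fin d) (Fin d) ℂ) - L) * D).trace.re =
      c * D.trace.re - (L * D).trace.re := by
  simp [sub_mul, trace_sub, trace_smul]

lemma tr_min_sub (L D : Matrix (Fin d) (Fin d) ℂ) (c : ℝ) :
    ((L - (c : ℂ) • (1 : Matrix (Fin d) (Fin d) ℂ)) * D).trace.re =
      (L * D).trace.re - c * D.trace.re := by
  simp [sub_mul, trace_sub, trace_smul]

lemma tr_le_max {L D : Matrix (Fin d) (Fin d) ℂ} (hL : L.IsHermitian) (hD : D.PosSemidef) :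
    (L * D).trace.re ≤ lamMax L * D.trace.re := by
  have := tr_mul_nonneg_re (max_psd hL) hD
  rw [tr_max_sub] at this; linarith

lemma min_le_tr {L D : Matrix (Fin d) (Fin d) ℂ} (hL : L.IsHermitian) (hD : D.PosSemidef) :
    lamMin L * D.trace.re ≤ (L * D).trace.re := by
  have := tr_mul_nonneg_re (min_psd hL) hD
  rw [tr_min_sub] at this; linarith

lemma lamMin_le_lamMax (hd : 1 ≤ d) (L : Matrix (Fin d) (Fin d) ℂ) : lamMin L ≤ lamMax L :=
  (lamMin_le L ⟨0, hd⟩).trans (le_lamMax L ⟨0, hd⟩)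

/-- `tr L(ω-σ) ≤ ε (λ₊-λ₋)` on the ball. -/
lemma tr_bound (hd : 1 ≤ d) {L X : Matrix (Fin d) (Fin d) ℂ} (hL : L.IsHermitian)
    (hX : X.IsHermitian) (hX0 : X.trace = 0) {ε : ℝ} (hb : (1 / 2 : ℝ) * traceNorm X ≤ ε) :
    (L * X).trace.re ≤ ε * (lamMax L - lamMin L) := by
  obtain ⟨A, B, hA, hB, rfl, ht⟩ := exists_jordan hX
  have e := congrArg Complex.re hX0
  rw [trace_sub, Complex.sub_re, Complex.zero_re] at e
  have a := tr_le_max hL hA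
  have b := min_le_tr hL hB
  have c := lamMin_le_lamMax hd L
  rw [mul_sub, trace_sub, Complex.sub_re]
  have hA' : A.trace.re ≤ ε := by linarith
  have hB' : B.trace.re = A.trace.re := by linarith
  rw [hB'] at b
  nlinarith [mul_nonneg (sub_nonneg.2 hA') (sub_nonneg.2 c)]

lemma proj_of_tr {P D K : Matrix (Fin d) (Fin d) ℂ} (hP : IsSupportProj P D)
    (hD : D.PosSemidef) (hK : K.PosSemidef) (h : (K * D).trace.re = 0) : P * K * P = 0 := by
  rw [trace_mul_comm] at h
  rw [supp_mul_zero hP (mul_eq_zero_of_tr hD hK h), zero_mul]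

lemma tr_of_proj {P D L : Matrix (Fin d) (Fin d) ℂ} (hP : IsSupportProj P D)
    (hD : D.PosSemidef) (c : ℝ) (h : P * L * P = (c : ℂ) • P) :
    (L * D).trace.re = c * D.trace.re := by
  have h1 : D * P = D := by
    have := congrArg conjTranspose hP.2.2.1
    rwa [conjTranspose_mul, hD.1.eq, hP.1.eq] at this
  have : (L * D).trace = ((P * L * P) * D).trace := by
    calc (L * D).trace = (L * (P * (D * P))).trace := by rw [h1, hP.2.2.1]
      _ = ((L * P * D) * P).trace := by simp only [mul_assoc]
      _ = _ := by rw [trace_mul_comm]; simp only [mul_assoc]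
  rw [this, h, smul_mul_assoc, hP.2.2.1, trace_smul]
  simp

lemma scalar_eigs {L : Matrix (Fin d) (Fin d) ℂ} (hL : L.IsHermitian) {c : ℝ}
    (h : L = (c : ℂ) • (1 : Matrix (Fin d) (Fin d) ℂ)) (i : Fin d) : eigs L i = c := by
  obtain ⟨Q, _, h2, _, h4⟩ := exists_eig hL i
  rw [← h4, h]
  simp [trace_smul, h2]

end GatAux

/-- Necessary and sufficient condition for a faithful state `ρ ∈ B_ε(σ)` to
maximize a concave continuous function `f` over `B_ε(σ)`, in terms of the Gâteaux gradient
`L` of `f` at `ρ`. -/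
theorem maximizer_iff_gateaux_condition
    {d : ℕ} (hd : 1 ≤ d)
    (σ : Matrix (Fin d) (Fin d) ℂ) (hσ : IsState σ)
    (ε : ℝ) (hε : ε ∈ Set.Ioc (0 : ℝ) 1)
    (f : Matrix (Fin d) (Fin d) ℂ → ℝ)
    (hconc : ∀ A B : Matrix (Fin d) (Fin d) ℂ, IsState A → IsState B →
      ∀ t : ℝ, 0 ≤ t → t ≤ 1 →
        t * f A + (1 - t) * f B ≤ f (t • A + (1 - t) • B))
    (hcont : ContinuousOn f {A : Matrix (Fin d) (Fin d) ℂ | IsState A})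
    (ρ : Matrix (Fin d) (Fin d) ℂ) (hρpd : ρ.PosDef) (hρtr : ρ.trace = 1)
    (hρball : (1 / 2 : ℝ) * traceNorm (ρ - σ) ≤ ε)
    (L : Matrix (Fin d) (Fin d) ℂ) (hL : L.IsHermitian)
    (hderiv : ∀ h : Matrix (Fin d) (Fin d) ℂ, h.IsHermitian → h.trace = 0 →
      Filter.Tendsto (fun t : ℝ => (f (ρ + t • h) - f ρ) / t)
        (nhdsWithin 0 (Set.Ioi (0 : ℝ))) (nhds (((L * h).trace).re)))
    (Δp Δn Pp Pn : Matrix (Fin d) (Fin d) ℂ)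
    (hΔp : Δp.PosSemidef) (hΔn : Δn.PosSemidef)
    (hJordan : ρ - σ = Δp - Δn) (hOrth : Δp * Δn = 0)
    (hPp : IsSupportProj Pp Δp) (hPn : IsSupportProj Pn Δn) :
    ((L * (ρ - σ)).trace).re ≤ ε * (lamMax L - lamMin L) ∧
    (((L * (ρ - σ)).trace).re = ε * (lamMax L - lamMin L) ↔
      ∀ ω : Matrix (Fin d) (Fin d) ℂ, IsState ω →
        (1 / 2 : ℝ) * traceNorm (ω - σ) ≤ ε → f ω ≤ f ρ) ∧
    (((L * (ρ - σ)).trace).re = ε * (lamMax L - lamMin L) ↔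
      (((1 / 2 : ℝ) * traceNorm (ρ - σ) = ε ∨
          ∃ c : ℝ, L = (c : ℂ) • (1 : Matrix (Fin d) (Fin d) ℂ)) ∧
       Pp * L * Pp = ((lamMax L : ℂ) • Pp) ∧
       Pn * L * Pn = ((lamMin L : ℂ) • Pn))) := by
  have hε0 : 0 < ε := hε.1
  have hσh : σ.IsHermitian := hσ.1.1
  have hXh : (ρ - σ).IsHermitian := hρpd.1.sub hσh
  have hX0 : (ρ - σ).trace = 0 := by rw [Matrix.trace_sub, hρtr, hσ.2, sub_self]
  have hρs : IsState ρ := ⟨hρpd.posSemidef, hρtr⟩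
  have hmm := GatAux.lamMin_le_lamMax hd L
  have : Nonempty (Fin d) := ⟨⟨0, hd⟩⟩
  have key := GatAux.tr_bound hd hL hXh hX0 hρball
  refine ⟨key, ⟨?_, ?_⟩, ?_⟩
  · intro heq ω hω hωb
    have hle := GatAux.tr_bound hd hL (hω.1.1.sub hσh)
      (by rw [Matrix.trace_sub, hω.2, hσ.2, sub_self]) hωb
    have ht := hderiv (ω - ρ) (hω.1.1.sub hρpd.1)
      (by rw [Matrix.trace_sub, hω.2, hρtr, sub_self])
    have hge : f ω - f ρ ≤ ((L * (ω - ρ)).trace).re := by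
      refine ge_of_tendsto ht ?_
      filter_upwards [Ioc_mem_nhdsGT (zero_lt_one (α := ℝ))] with t ht
      rw [le_div_iff₀ ht.1]
      have hc := hconc ω ρ hω hρs t ht.1.le ht.2
      have he : ρ + t • (ω - ρ) = t • ω + (1 - t) • ρ := by
        rw [smul_sub, sub_smul, one_smul]; abel
      rw [he]; nlinarith
    have hs : ω - ρ = (ω - σ) - (ρ - σ) := by abel
    rw [hs, mul_sub, Matrix.trace_sub, Complex.sub_re] at hge
    linarith
  · intro hmax
    obtain ⟨i, hi⟩ := exists_eq_ciSup_of_finite (f := eigs L)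
    obtain ⟨j, hj⟩ := exists_eq_ciInf_of_finite (f := eigs L)
    obtain ⟨k, hk⟩ := exists_eq_ciInf_of_finite (f := eigs ρ)
    obtain ⟨Q, q1, q2, q3, q4⟩ := GatAux.exists_eig hL i
    obtain ⟨R, r1, r2, r3, r4⟩ := GatAux.exists_eig hL j
    have hi' : eigs L i = lamMax L := hi
    have hj' : eigs L j = lamMin L := hj
    have hk' : eigs ρ k = lamMin ρ := hk
    have hc : 0 < lamMin ρ := by
      rw [← hk']
      have : eigs ρ = hρpd.1.eigenvalues := by simp [eigs, hρpd.1]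
      rw [this]; exact hρpd.eigenvalues_pos k
    have hρm := GatAux.min_psd hρpd.1
    set c := lamMin ρ
    obtain ⟨A, B, hA, hB, hAB, htn⟩ := GatAux.exists_jordan hXh
    have hh : (ε • (Q - R) - (ρ - σ)).IsHermitian := by
      refine Matrix.IsHermitian.sub ?_ hXh
      have := q1.1.sub r1.1
      rw [Matrix.IsHermitian, Matrix.conjTranspose_smul, this.eq]; simp
    have hh0 : (ε • (Q - R) - (ρ - σ)).trace = 0 := by
      rw [Matrix.trace_sub, hX0, Matrix.trace_smul, Matrix.trace_sub, q2, r2]; simp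
    have ht := hderiv _ hh hh0
    have hle : ((L * (ε • (Q - R) - (ρ - σ))).trace).re ≤ 0 := by
      refine le_of_tendsto ht ?_
      have hpos : 0 < min 1 (c / (c + ε)) := lt_min one_pos (by positivity)
      filter_upwards [Ioc_mem_nhdsGT hpos] with t ht
      have t0 : 0 < t := ht.1
      have t1 : t ≤ 1 := ht.2.trans (min_le_left _ _)
      have t2 : t * (c + ε) ≤ c := by
        have := ht.2.trans (min_le_right _ _)
        rwa [le_div_iff₀ (by positivity)] at this
      apply div_nonpos_of_nonpos_of_nonneg _ t0.le
      rw [sub_nonpos]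
      apply hmax
      · constructor
        · have : ρ + t • (ε • (Q - R) - (ρ - σ)) =
              (1 - t) • (ρ - (c : ℂ) • (1 : Matrix (Fin d) (Fin d) ℂ)) + t • σ + (t * ε) • Q +
              (t * ε) • (1 - R) + (c - t * (c + ε)) • (1 : Matrix (Fin d) (Fin d) ℂ) := by
            rw [Complex.coe_smul]
            module
          rw [this]
          exact ((((hρm.smul (by linarith)).add (hσ.1.smul t0.le)).add
            (q1.smul (by positivity))).add (r3.smul (by positivity))).add
            (Matrix.PosSemidef.one.smul (by linarith))
        · rw [Matrix.trace_add, Matrix.trace_smul, hh0, hρtr]; simp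
      · have : ρ + t • (ε • (Q - R) - (ρ - σ)) - σ =
            ((1 - t) • A + (t * ε) • Q) - ((1 - t) • B + (t * ε) • R) := by
          have : ρ + t • (ε • (Q - R) - (ρ - σ)) - σ = (1 - t) • (ρ - σ) + (t * ε) • (Q - R) := by
            module
          rw [this, hAB]; module
        rw [this]
        have t3 : 0 ≤ 1 - t := by linarith
        have t4 : 0 ≤ t * ε := by positivity
        have b := GatAux.traceNorm_le ((hA.smul t3).add (q1.smul t4))
          ((hB.smul t3).add (r1.smul t4))
        simp only [Matrix.trace_add, Matrix.trace_smul, q2, r2, Complex.add_re, Complex.real_smul,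
          Complex.re_ofReal_mul, Complex.one_re] at b
        nlinarith
    have e : ((L * (ε • (Q - R) - (ρ - σ))).trace).re =
        ε * (lamMax L - lamMin L) - ((L * (ρ - σ)).trace).re := by
      rw [mul_sub, Matrix.trace_sub, mul_smul_comm, Matrix.trace_smul, mul_sub L Q R,
        Matrix.trace_sub, Complex.sub_re, Complex.real_smul, Complex.re_ofReal_mul,
        Complex.sub_re, q4, r4, hi', hj']
    linarith
  · have hn := GatAux.jordan_traceNorm hΔp hΔn hOrth hPp hPn
    rw [← hJordan] at hn
    have h0 := congrArg Complex.re hX0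
    rw [hJordan, Matrix.trace_sub, Complex.sub_re, Complex.zero_re] at h0
    have hp : (1 / 2 : ℝ) * traceNorm (ρ - σ) = Δp.trace.re := by linarith
    have hpn : Δn.trace.re = Δp.trace.re := by linarith
    rw [hp] at hρball ⊢
    have hsplit : ((L * (ρ - σ)).trace).re = (L * Δp).trace.re - (L * Δn).trace.re := by
      rw [hJordan, mul_sub, Matrix.trace_sub, Complex.sub_re]
    rw [hsplit]
    have a := GatAux.tr_le_max hL hΔp
    have b := GatAux.min_le_tr hL hΔn
    rw [hpn] at b
    have hprod := mul_nonneg (sub_nonneg.2 hρball) (sub_nonneg.2 hmm)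
    constructor
    · intro heq
      have e0 : (ε - Δp.trace.re) * (lamMax L - lamMin L) = 0 := by nlinarith
      have e1 : (L * Δp).trace.re = lamMax L * Δp.trace.re := by nlinarith
      have e2 : (L * Δn).trace.re = lamMin L * Δn.trace.re := by rw [hpn]; nlinarith
      refine ⟨?_, ?_, ?_⟩
      · rcases mul_eq_zero.1 e0 with h | h
        · left; linarith
        · right
          refine ⟨lamMax L, ?_⟩
          have h1 := GatAux.max_psd hL
          have h2 := GatAux.min_psd hL
          have h3 : lamMin L = lamMax L := by linarith
          rw [h3] at h2
          have t1 := h1.trace_nonneg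
          have t2 := h2.trace_nonneg
          rw [← neg_sub, Matrix.trace_neg] at t2
          have t3 := (h1.trace_eq_zero_iff).1 (le_antisymm (neg_nonneg.1 t2) t1)
          exact (sub_eq_zero.1 t3).symm
      · have := GatAux.proj_of_tr hPp hΔp (GatAux.max_psd hL)
          (by rw [GatAux.tr_max_sub, e1]; ring)
        rw [mul_sub, sub_mul, sub_eq_zero] at this
        rw [← this]; simp [hPp.2.1]
      · have := GatAux.proj_of_tr hPn hΔn (GatAux.min_psd hL)
          (by rw [GatAux.tr_min_sub, e2]; ring)
        rw [mul_sub, sub_mul, sub_eq_zero] at this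
        rw [this]; simp [hPn.2.1]
    · rintro ⟨h1, h2, h3⟩
      rw [GatAux.tr_of_proj hPp hΔp _ h2, GatAux.tr_of_proj hPn hΔn _ h3, hpn]
      rcases h1 with h1 | ⟨c, h1⟩
      · rw [h1]; ring
      · have m1 : lamMax L = c := by simp [lamMax, GatAux.scalar_eigs hL h1]
        have m2 : lamMin L = c := by simp [lamMin, GatAux.scalar_eigs hL h1]
        rw [m1, m2]; ring
end
end
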